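/- Let T be an irreducible triangulation of a closed surface other than the sphere and let v be a vertex of T. Then there exist two nonseparating 3-cycles v vi vk and v vj vl through v such that vi, vj, vk, vl are distinct vertices of the link of v, one of the two arcs of lk(v) from vi to vk contains vj, and the other arc contains vl. -/

import Mathlib

open Finset

open scoped Classical

/-! Combinatorial model of triangulations of closed surfaces.
A triangulation is encoded by its finite set of triangular faces (3-element
vertex sets).  Surface-ness is expressed by: every edge lies in exactly two
faces, the link of every vertex is connected (hence a single cycle), and the
whole complex is connected. -/

variable {V : Type*} {W : Type*}

/-- Two faces are adjacent when they share an edge. -/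
def FaceAdj [DecidableEq V] (faces : Finset (Finset V)) (A B : Finset V) : Prop :=
  A ∈ faces ∧ B ∈ faces ∧ (A ∩ B).card = 2

/-- Two faces at a vertex `v` are adjacent when they share an edge through `v`. -/
def LinkAdj [DecidableEq V] (faces : Finset (Finset V)) (v : V) (A B : Finset V) : Prop :=
  A ∈ faces ∧ B ∈ faces ∧ v ∈ A ∩ B ∧ (A ∩ B).card = 2

/-- `faces` is the set of faces of a triangulation of a closed surface. -/
structure IsTriangulation [DecidableEq V] (faces : Finset (Finset V)) : Prop where
  nonempty : faces.Nonempty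
  card_three : ∀ F ∈ faces, F.card = 3
  edge_two_faces : ∀ e : Finset V, e.card = 2 → (∃ F ∈ faces, e ⊆ F) →
    (faces.filter fun F => e ⊆ F).card = 2
  link_connected : ∀ v : V, ∀ F ∈ faces, ∀ G ∈ faces, v ∈ F → v ∈ G →
    Relation.ReflTransGen (LinkAdj faces v) F G
  connected : ∀ F ∈ faces, ∀ G ∈ faces, Relation.ReflTransGen (FaceAdj faces) F G

/-- The vertices of a triangulation. -/
def vertexSet [DecidableEq V] (faces : Finset (Finset V)) : Finset V :=
  faces.biUnion id

/-- The edges of a triangulation: the 2-element subsets of faces. -/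
noncomputable def edgeSet [DecidableEq V] (faces : Finset (Finset V)) : Finset (Finset V) :=
  ((vertexSet faces).powersetCard 2).filter fun e => ∃ F ∈ faces, e ⊆ F

/-- Euler characteristic `n - e + f`. -/
noncomputable def eulerChar [DecidableEq V] (faces : Finset (Finset V)) : ℤ :=
  ((vertexSet faces).card : ℤ) - ((edgeSet faces).card : ℤ) + (faces.card : ℤ)

/-- Euler genus `2 - χ`. -/
noncomputable def eulerGenus [DecidableEq V] (faces : Finset (Finset V)) : ℤ :=
  2 - eulerChar faces

/-- The degree of a vertex. -/
noncomputable def degree [DecidableEq V] (faces : Finset (Finset V)) (v : V) : ℕ :=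
  ((edgeSet faces).filter fun e => v ∈ e).card

/-- Adjacency of vertices in a triangulation. -/
def Adj [DecidableEq V] (faces : Finset (Finset V)) (a b : V) : Prop :=
  a ≠ b ∧ ∃ F ∈ faces, ({a, b} : Finset V) ⊆ F

/-- A 3-cycle of the graph of the triangulation: three pairwise adjacent vertices. -/
noncomputable def IsTriCycle [DecidableEq V] (faces : Finset (Finset V)) (C : Finset V) : Prop :=
  C.card = 3 ∧ ∀ e ∈ C.powersetCard 2, e ∈ edgeSet faces

/-- A nonfacial 3-cycle: a 3-cycle which does not bound a face. -/
noncomputable def IsNonfacialTriCycle [DecidableEq V] (faces : Finset (Finset V))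
    (C : Finset V) : Prop :=
  IsTriCycle faces C ∧ C ∉ faces

/-- The number of 3-cycles containing a given edge (= common neighbours of its ends). -/
noncomputable def numTriCyclesOn [DecidableEq V] (faces : Finset (Finset V))
    (e : Finset V) : ℕ :=
  ((vertexSet faces).filter fun x => x ∉ e ∧ ∀ y ∈ e, Adj faces x y).card

/-- Contraction of the edge `ac` (the vertex `c` is identified with `a`,
the two faces containing `ac` collapse, multiple edges/faces merge). -/
def contract [DecidableEq V] (faces : Finset (Finset V)) (a c : V) : Finset (Finset V) :=
  (faces.filter fun F => ¬ (a ∈ F ∧ c ∈ F)).image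
    (Finset.image fun x => if x = c then a else x)

/-- A coherent cyclic orientation of one triangular face, given as the set of its three
directed edges. -/
def IsCyclicOrientation [DecidableEq V] (F : Finset V) (d : Finset (V × V)) : Prop :=
  d.card = 3 ∧ (∀ p ∈ d, p.1 ∈ F ∧ p.2 ∈ F ∧ p.1 ≠ p.2) ∧
  (∀ x ∈ F, (d.filter fun p => p.1 = x).card = 1 ∧ (d.filter fun p => p.2 = x).card = 1)

/-- Orientability: the faces can be coherently oriented (each directed edge is used
by at most one oriented face). -/
def Orientable [DecidableEq V] (faces : Finset (Finset V)) : Prop :=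
  ∃ or : Finset V → Finset (V × V),
    (∀ F ∈ faces, IsCyclicOrientation F (or F)) ∧
    (∀ F ∈ faces, ∀ G ∈ faces, F ≠ G → ∀ p ∈ or F, p ∉ or G)

/-- Two (connected, closed) triangulated surfaces are the same surface iff they have the
same Euler characteristic and the same orientability. -/
noncomputable def SameSurface [DecidableEq V] (f₁ f₂ : Finset (Finset V)) : Prop :=
  eulerChar f₁ = eulerChar f₂ ∧ (Orientable f₁ ↔ Orientable f₂)

/-- The edge `ac` is contractible: contracting it yields again a triangulation
of the same surface. -/
noncomputable def Contractible [DecidableEq V] (faces : Finset (Finset V)) (a c : V) : Prop :=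
  ({a, c} : Finset V) ∈ edgeSet faces ∧ IsTriangulation (contract faces a c) ∧
    SameSurface (contract faces a c) faces

/-- An edge (as a 2-element set) is contractible. -/
noncomputable def ContractibleEdge [DecidableEq V] (faces : Finset (Finset V))
    (e : Finset V) : Prop :=
  ∃ a c : V, e = ({a, c} : Finset V) ∧ Contractible faces a c

/-- An irreducible triangulation: no edge is contractible. -/
noncomputable def IrreducibleTri [DecidableEq V] (faces : Finset (Finset V)) : Prop :=
  IsTriangulation faces ∧ ∀ e ∈ edgeSet faces, ¬ ContractibleEdge faces e

/-- Face adjacency avoiding the edges of the cycle with vertex set `C`. -/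
def SeparatesRel [DecidableEq V] (faces : Finset (Finset V)) (C : Finset V)
    (A B : Finset V) : Prop :=
  A ∈ faces ∧ B ∈ faces ∧ (A ∩ B).card = 2 ∧ ¬ (A ∩ B ⊆ C)

/-- A cycle with vertex set `C` is nonseparating iff the complement of the embedded
curve is connected, i.e. any two faces are joined by a path of faces never crossing
an edge of the cycle. -/
def Nonseparating [DecidableEq V] (faces : Finset (Finset V)) (C : Finset V) : Prop :=
  ∀ A ∈ faces, ∀ B ∈ faces, Relation.ReflTransGen (SeparatesRel faces C) A B

/-- A corner of the cycle `C`: a vertex of `C` together with a face containing it. -/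
def Corner [DecidableEq V] (faces : Finset (Finset V)) (C : Finset V)
    (p : V × Finset V) : Prop :=
  p.1 ∈ C ∧ p.2 ∈ faces ∧ p.1 ∈ p.2

/-- Adjacency of corners of `C`: move inside a link avoiding the cycle, or move along
a face containing an edge of the cycle.  The connected components of this relation
are the boundary curves of a regular neighbourhood of the cycle. -/
def CornerRel [DecidableEq V] (faces : Finset (Finset V)) (C : Finset V)
    (p q : V × Finset V) : Prop :=
  Corner faces C p ∧ Corner faces C q ∧
    ((p.1 = q.1 ∧ (p.2 ∩ q.2).card = 2 ∧ p.1 ∈ p.2 ∩ q.2 ∧ ¬ (p.2 ∩ q.2 ⊆ C)) ∨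
     (p.2 = q.2 ∧ p.1 ≠ q.1))

/-- A cycle is one-sided iff a regular neighbourhood of it is a Möbius band, i.e. the
neighbourhood has a single boundary curve: all corners are connected. -/
def OneSided [DecidableEq V] (faces : Finset (Finset V)) (C : Finset V) : Prop :=
  ∀ p q, Corner faces C p → Corner faces C q →
    Relation.ReflTransGen (CornerRel faces C) p q

/-- `ℓ` enumerates the link of `a` cyclically: the faces at `a` are exactly the
triangles `a ℓᵢ ℓᵢ₊₁`. -/
def IsLink [DecidableEq V] (faces : Finset (Finset V)) (a : V) (d : ℕ)
    (ℓ : ZMod d → V) : Prop :=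
  Function.Injective ℓ ∧ (∀ i, ℓ i ≠ a) ∧
    ∀ F : Finset V, (F ∈ faces ∧ a ∈ F) ↔ ∃ i : ZMod d, F = {a, ℓ i, ℓ (i + 1)}

/-- Splitting the vertex `a` along `ℓ₀ a ℓₛ₋₁` (paper's `v₁ a vₛ`): the vertex `a`
becomes the two vertices `a₁ = Sum.inl a` and `a₂ = Sum.inr ()`. -/
noncomputable def splitFaces [DecidableEq V] (faces : Finset (Finset V)) (a : V) {d : ℕ}
    (ℓ : ZMod d → V) (s : ℕ) : Finset (Finset (V ⊕ Unit)) :=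
  ((faces.filter fun F => a ∉ F).image (Finset.image Sum.inl)) ∪
  ((Finset.range (s - 1)).image fun i =>
    ({Sum.inl a, Sum.inl (ℓ (i : ZMod d)), Sum.inl (ℓ ((i : ZMod d) + 1))} :
      Finset (V ⊕ Unit))) ∪
  ((Finset.Ico (s - 1) d).image fun i =>
    ({Sum.inr (), Sum.inl (ℓ (i : ZMod d)), Sum.inl (ℓ ((i : ZMod d) + 1))} :
      Finset (V ⊕ Unit))) ∪
  {({Sum.inl a, Sum.inr (), Sum.inl (ℓ (0 : ZMod d))} : Finset (V ⊕ Unit)),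
   ({Sum.inl a, Sum.inr (), Sum.inl (ℓ ((s - 1 : ℕ) : ZMod d))} : Finset (V ⊕ Unit))}

/-- Renaming of vertices when cutting along a two-sided 3-cycle `w₀w₁w₂`:
faces with `side = true` keep the original vertices, faces with `side = false`
get the new copies `Sum.inr i`. -/
noncomputable def renameTwoSided [DecidableEq V] (w : Fin 3 → V) (s : Bool) (x : V) : V ⊕ Fin 3 :=
  if x = w 0 then (if s then Sum.inl x else Sum.inr 0)
  else if x = w 1 then (if s then Sum.inl x else Sum.inr 1)
  else if x = w 2 then (if s then Sum.inl x else Sum.inr 2)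
  else Sum.inl x

/-- A coherent side assignment for cutting along the two-sided 3-cycle with vertex
set `C`: constant along link arcs avoiding the cycle, and the two faces on an edge
of the cycle lie on opposite sides. -/
def CoherentSide [DecidableEq V] (faces : Finset (Finset V)) (C : Finset V)
    (side : Finset V → Bool) : Prop :=
  (∀ F ∈ faces, ∀ G ∈ faces, (F ∩ G).card = 2 → ((F ∩ G) ∩ C).Nonempty →
      ¬ (F ∩ G ⊆ C) → side F = side G) ∧
  (∀ F ∈ faces, ∀ G ∈ faces, F ≠ G → (F ∩ G).card = 2 → F ∩ G ⊆ C → side F ≠ side G)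

/-- Cut along a two-sided 3-cycle and cap the two resulting boundary 3-cycles
with two new triangular faces. -/
noncomputable def cutCapTwoSided [DecidableEq V] (faces : Finset (Finset V)) (w : Fin 3 → V)
    (side : Finset V → Bool) : Finset (Finset (V ⊕ Fin 3)) :=
  (faces.image fun F => F.image (renameTwoSided w (side F))) ∪
  {({Sum.inl (w 0), Sum.inl (w 1), Sum.inl (w 2)} : Finset (V ⊕ Fin 3)),
   ({Sum.inr 0, Sum.inr 1, Sum.inr 2} : Finset (V ⊕ Fin 3))}

/-- The six edges of the boundary hexagon `u₁u₂u₃v₁v₂v₃` produced by cutting along a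
one-sided 3-cycle; `(i, true)` is `uᵢ₊₁` and `(i, false)` is `vᵢ₊₁`. -/
def hexEdges : Finset (Finset (Fin 3 × Bool)) :=
  { ({(0, true), (1, true)} : Finset (Fin 3 × Bool)),
    ({(1, true), (2, true)} : Finset (Fin 3 × Bool)),
    ({(2, true), (0, false)} : Finset (Fin 3 × Bool)),
    ({(0, false), (1, false)} : Finset (Fin 3 × Bool)),
    ({(1, false), (2, false)} : Finset (Fin 3 × Bool)),
    ({(2, false), (0, true)} : Finset (Fin 3 × Bool)) }

/-- Renaming of vertices when cutting along a one-sided 3-cycle: the vertex `w i` of a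
face becomes the copy `(i, σ i)` on the boundary hexagon. -/
noncomputable def renameOneSided [DecidableEq V] (w : Fin 3 → V) (σ : Fin 3 → Bool) (x : V) :
    V ⊕ (Fin 3 × Bool) ⊕ Unit :=
  if x = w 0 then Sum.inr (Sum.inl (0, σ 0))
  else if x = w 1 then Sum.inr (Sum.inl (1, σ 1))
  else if x = w 2 then Sum.inr (Sum.inl (2, σ 2))
  else Sum.inl x

/-- Coherence of the corner assignment `σ` for cutting along a one-sided 3-cycle
`w₀w₁w₂`: constant along link arcs avoiding the cycle, each face on an edge of the
cycle produces an edge of the boundary hexagon, and each hexagon edge is produced by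
exactly one face. -/
noncomputable def CoherentOneSided [DecidableEq V] (faces : Finset (Finset V)) (w : Fin 3 → V)
    (σ : Finset V → Fin 3 → Bool) : Prop :=
  (∀ F ∈ faces, ∀ G ∈ faces, ∀ i : Fin 3, (F ∩ G).card = 2 → w i ∈ F ∩ G →
      ¬ (F ∩ G ⊆ ({w 0, w 1, w 2} : Finset V)) → σ F i = σ G i) ∧
  (∀ F ∈ faces, ∀ i j : Fin 3, i ≠ j → ({w i, w j} : Finset V) ⊆ F →
      ({(i, σ F i), (j, σ F j)} : Finset (Fin 3 × Bool)) ∈ hexEdges) ∧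
  (∀ h ∈ hexEdges,
    (faces.filter fun F => ∃ i j : Fin 3, i ≠ j ∧ ({w i, w j} : Finset V) ⊆ F ∧
      ({(i, σ F i), (j, σ F j)} : Finset (Fin 3 × Bool)) = h).card = 1)

/-- Cut along a one-sided 3-cycle and cap the resulting boundary hexagon with a new
vertex `t' = Sum.inr (Sum.inr ())` joined to the six boundary vertices. -/
noncomputable def cutCapOneSided [DecidableEq V] (faces : Finset (Finset V)) (w : Fin 3 → V)
    (σ : Finset V → Fin 3 → Bool) : Finset (Finset (V ⊕ (Fin 3 × Bool) ⊕ Unit)) :=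
  (faces.image fun F => F.image (renameOneSided w (σ F))) ∪
  (hexEdges.image fun h =>
    insert (Sum.inr (Sum.inr ()))
      (h.image fun p => (Sum.inr (Sum.inl p) : V ⊕ (Fin 3 × Bool) ⊕ Unit)))

/-- Adding a handle: remove the faces `abc` and `def` and identify `d ↦ a`, `e ↦ b`,
`f ↦ c`. -/
noncomputable def glueHandle [DecidableEq V] (faces : Finset (Finset V)) (a b c d e f : V) :
    Finset (Finset V) :=
  ((faces \ {({a, b, c} : Finset V), ({d, e, f} : Finset V)}).image
    (Finset.image fun x => if x = d then a else if x = e then b else if x = f then c else x))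

/-- Adding a crosscap at a degree six vertex `t` with link `ℓ₀ … ℓ₅`: remove `t` with
its incident edges and faces and identify opposite vertices of the hexagonal hole. -/
noncomputable def addCrosscap [DecidableEq V] (faces : Finset (Finset V)) (t : V) (ℓ : ZMod 6 → V) :
    Finset (Finset V) :=
  (faces.filter fun F => t ∉ F).image
    (Finset.image fun x =>
      if x = ℓ 3 then ℓ 0 else if x = ℓ 4 then ℓ 1 else if x = ℓ 5 then ℓ 2 else x)

/-- Connected sum of two triangulations along the faces `abc` and `def`. -/
noncomputable def glueSum [DecidableEq V] [DecidableEq W] (f₁ : Finset (Finset V))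
    (f₂ : Finset (Finset W)) (a b c : V) (d e f : W) : Finset (Finset (V ⊕ W)) :=
  ((f₁.erase {a, b, c}).image (Finset.image Sum.inl)) ∪
  ((f₂.erase {d, e, f}).image (Finset.image fun y =>
    if y = d then Sum.inl a else if y = e then Sum.inl b
    else if y = f then Sum.inl c else (Sum.inr y : V ⊕ W)))


section Aux
variable [DecidableEq V]

/-- Through an edge of a face there is exactly one other face. -/
theorem aux_other {T : Finset (Finset V)} (hT : IsTriangulation T) {u z : V} (huz : u ≠ z)
    {F : Finset V} (hF : F ∈ T) (hu : u ∈ F) (hz : z ∈ F) :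
    ∃ G ∈ T, G ≠ F ∧ u ∈ G ∧ z ∈ G ∧ ∀ K ∈ T, u ∈ K → z ∈ K → K = F ∨ K = G := by
  have h2 := hT.edge_two_faces {u, z} (card_pair huz) ⟨F, hF, by
    intro t ht; simp at ht; rcases ht with rfl | rfl <;> assumption⟩
  rw [card_eq_two] at h2
  obtain ⟨A, B, hAB, h⟩ := h2
  have key : ∀ K, (K ∈ T ∧ u ∈ K ∧ z ∈ K) ↔ (K = A ∨ K = B) := by
    intro K
    have := congrArg (K ∈ ·) h
    simp [insert_subset_iff] at this
    rw [← this]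
  have hA := (key A).2 (Or.inl rfl)
  have hB := (key B).2 (Or.inr rfl)
  rcases (key F).1 ⟨hF, hu, hz⟩ with rfl | rfl
  · exact ⟨B, hB.1, hAB.symm, hB.2.1, hB.2.2, fun K h1 h2 h3 => (key K).1 ⟨h1, h2, h3⟩⟩
  · exact ⟨A, hA.1, hAB, hA.2.1, hA.2.2, fun K h1 h2 h3 => ((key K).1 ⟨h1, h2, h3⟩).symm⟩

theorem aux_third {F : Finset V} (hF : F.card = 3) {u z : V} (huz : u ≠ z) (hu : u ∈ F)
    (hz : z ∈ F) : ∃ p, p ≠ u ∧ p ≠ z ∧ F = {u, z, p} := by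
  have : ((F.erase u).erase z).card = 1 := by
    rw [card_erase_of_mem (by simp [hz, huz.symm]), card_erase_of_mem hu]; omega
  rw [card_eq_one] at this
  obtain ⟨p, hp⟩ := this
  have hp' : p ∈ (F.erase u).erase z := by rw [hp]; simp
  simp at hp'
  refine ⟨p, hp'.2.1, hp'.1, ?_⟩
  ext t
  have := congrArg (t ∈ ·) hp
  simp at this
  simp only [mem_insert, mem_singleton]
  by_cases h1 : t = u
  · subst h1; simp [hu]
  · by_cases h2 : t = z
    · subst h2; simp [hz]
    · simp [h1, h2] at this ⊢; exact this

theorem aux_card_three {u z p : V} (h1 : u ≠ z) (h2 : u ≠ p) (h3 : z ≠ p) :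
    ({u, z, p} : Finset V).card = 3 := by
  rw [card_eq_three]; exact ⟨u, z, p, h1, h2, h3, rfl⟩

theorem aux_eq_of_three {F : Finset V} (hF : F.card = 3) {u z p : V} (h1 : u ≠ z) (h2 : u ≠ p)
    (h3 : z ≠ p) (hu : u ∈ F) (hz : z ∈ F) (hp : p ∈ F) : F = {u, z, p} := by
  symm
  apply eq_of_subset_of_card_le
  · intro t ht; simp at ht; rcases ht with rfl | rfl | rfl <;> assumption
  · rw [hF, aux_card_three h1 h2 h3]

/-- Two distinct 3-sets with two common elements meet in exactly two elements. -/
theorem aux_inter_card {F G : Finset V} (hF : F.card = 3) (hG : G.card = 3) (hFG : F ≠ G)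
    {u z : V} (huz : u ≠ z) (h1 : u ∈ F) (h2 : z ∈ F) (h3 : u ∈ G) (h4 : z ∈ G) :
    F ∩ G = {u, z} := by
  symm
  apply eq_of_subset_of_card_le
  · intro t ht; simp at ht; rcases ht with rfl | rfl <;> simp [*]
  · rw [card_pair huz]
    by_contra hlt
    have h5 : (F ∩ G).card = 3 := by
      have := card_le_card (inter_subset_left (s₁ := F) (s₂ := G)); omega
    have h6 : F ∩ G = F := eq_of_subset_of_card_le inter_subset_left (by omega)
    have h7 : F ∩ G = G := eq_of_subset_of_card_le inter_subset_right (by omega)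
    exact hFG (h6.symm.trans h7)

theorem aux_adj_pair {F G : Finset V} (w : V) (hw : w ∈ F ∩ G) (h : (F ∩ G).card = 2) :
    ∃ z, z ≠ w ∧ z ∈ F ∧ z ∈ G ∧ F ∩ G = {w, z} := by
  rw [card_eq_two] at h
  obtain ⟨p, q, hpq, h⟩ := h
  rw [h] at hw
  simp at hw
  have hp : p ∈ F ∩ G := by rw [h]; simp
  have hq : q ∈ F ∩ G := by rw [h]; simp
  simp at hp hq
  rcases hw with rfl | rfl
  · exact ⟨q, hpq.symm, hq.1, hq.2, h⟩
  · exact ⟨p, hpq, hp.1, hp.2, by rw [h, pair_comm]⟩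

/-- Handshake parity at a vertex. -/
theorem aux_parity (w p : V) (S : Finset (Finset V)) (hS : ∀ F ∈ S, F.card = 3 ∧ w ∈ F)
    (hev : ∀ z, z ≠ w → z ≠ p → Even (S.filter fun F => z ∈ F).card) (hp : p ≠ w) :
    Even (S.filter fun F => p ∈ F).card := by
  have h1 : ∑ F ∈ S, (F.erase w).card
      = ∑ z ∈ (S.biUnion id ∪ {p}).erase w, (S.filter fun F => z ∈ F).card := by
    have := sum_card_bipartiteAbove_eq_sum_card_bipartiteBelow (s := S)
      (t := (S.biUnion id ∪ {p}).erase w) (fun F z => z ∈ F)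
    simp only [bipartiteAbove, bipartiteBelow] at this
    rw [← this]
    apply sum_congr rfl
    intro F hF
    congr 1
    ext t
    simp only [mem_erase, mem_filter, mem_union, mem_biUnion, mem_singleton, id]
    constructor
    · rintro ⟨h1, h2⟩; exact ⟨⟨h1, Or.inl ⟨F, hF, h2⟩⟩, h2⟩
    · rintro ⟨⟨h1, _⟩, h2⟩; exact ⟨h1, h2⟩
  have h2 : ∑ F ∈ S, (F.erase w).card = S.card * 2 := by
    rw [sum_const_nat]
    intro F hF
    rw [card_erase_of_mem (hS F hF).2, (hS F hF).1]
  have hpm : p ∈ (S.biUnion id ∪ {p}).erase w := by simp [hp]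
  rw [h2, ← add_sum_erase _ _ hpm] at h1
  have h3 : Even (∑ z ∈ ((S.biUnion id ∪ {p}).erase w).erase p, (S.filter fun F => z ∈ F).card) := by
    apply even_sum
    intro z hz
    simp only [mem_erase] at hz
    exact hev z hz.2.1 hz.1
  have h4 : Even (S.card * 2) := even_two.mul_left _
  rw [h1] at h4
  exact (Nat.even_add.1 h4).2 h3

/-- In a closed family of faces at `w`, an edge number is even. -/
theorem aux_even_closed {T : Finset (Finset V)} (hT : IsTriangulation T) (w z : V) (hz : z ≠ w)
    (P : Finset V → Prop) (hP : ∀ F ∈ T, ∀ G ∈ T, w ∈ F → z ∈ F → w ∈ G → z ∈ G → P F → P G) :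
    Even ((T.filter fun F => w ∈ F ∧ P F).filter fun F => z ∈ F).card := by
  by_cases h : ∃ F ∈ T, w ∈ F ∧ z ∈ F ∧ P F
  · obtain ⟨F, hF, hw, hzF, hPF⟩ := h
    have h2 := hT.edge_two_faces {w, z} (card_pair hz.symm) ⟨F, hF, by
      intro t ht; simp at ht; rcases ht with rfl | rfl <;> assumption⟩
    have : ((T.filter fun F => w ∈ F ∧ P F).filter fun F => z ∈ F)
        = T.filter fun F => {w, z} ⊆ F := by
      ext G
      simp only [mem_filter, insert_subset_iff, singleton_subset_iff]
      constructor
      · tauto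
      · rintro ⟨h1, h2, h3⟩; exact ⟨⟨h1, h2, hP F hF G h1 hw hzF h2 h3 hPF⟩, h3⟩
    rw [this, h2]; exact even_two
  · have : ((T.filter fun F => w ∈ F ∧ P F).filter fun F => z ∈ F) = ∅ := by
      ext G
      simp only [mem_filter, notMem_empty, iff_false]
      rintro ⟨⟨h1, h2, h3⟩, h4⟩
      exact h ⟨G, h1, h2, h4, h3⟩
    rw [this]; simp

/-- Propagation of a predicate on faces around a vertex. -/
theorem aux_star {T : Finset (Finset V)} (hT : IsTriangulation T) (w : V)
    (P : Finset V → Prop)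
    (hP : ∀ F ∈ T, ∀ G ∈ T, w ∈ F → w ∈ G → (F ∩ G).card = 2 → P F → P G)
    {F G : Finset V} (hF : F ∈ T) (hG : G ∈ T) (hw : w ∈ F) (hw' : w ∈ G) (h : P F) : P G := by
  have := hT.link_connected w F hF G hG hw hw'
  induction this with
  | refl => exact h
  | tail _ hbc ih =>
    obtain ⟨h1, h2, h3, h4⟩ := hbc
    simp at h3
    exact hP _ h1 _ h2 h3.1 h3.2 h4 (ih h1 h3.1)

theorem aux_all {T : Finset (Finset V)} (hT : IsTriangulation T)
    (P : Finset V → Prop)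
    (hP : ∀ F ∈ T, ∀ G ∈ T, (F ∩ G).card = 2 → P F → P G)
    {F G : Finset V} (hF : F ∈ T) (hG : G ∈ T) (h : P F) : P G := by
  have := hT.connected F hF G hG
  induction this with
  | refl => exact h
  | tail _ hbc ih =>
    obtain ⟨h1, h2, h4⟩ := hbc
    exact hP _ h1 _ h2 h4 (ih h1)

/-- Key lemma on an arc at `w`: if `P` is preserved when rotating around `w` except possibly
across the edge `w q`, and `P` is true for some face at `w`,
then it is true for all faces on `w q`. -/
theorem aux_arc {T : Finset (Finset V)} (hT : IsTriangulation T) (w q : V)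
    (hq : q ≠ w) (P : Finset V → Prop)
    (hP : ∀ F ∈ T, ∀ G ∈ T, ∀ z, z ≠ w → z ≠ q → w ∈ F → w ∈ G → z ∈ F → z ∈ G → P F → P G)
    (hpT : ∃ F ∈ T, w ∈ F ∧ P F) :
    ∀ F ∈ T, w ∈ F → q ∈ F → P F := by
  intro F hF hwF hqF
  by_contra hnF
  obtain ⟨G, hG, hGF, hwG, hqG, hun⟩ := aux_other hT hq.symm hF hwF hqF
  by_cases hPG : P G
  · -- exactly one face on `w q` satisfies `P`: parity
    have hev := aux_parity w q (T.filter fun F => w ∈ F ∧ P F)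
      (fun F hF => by simp at hF; exact ⟨hT.card_three F hF.1, hF.2.1⟩)
      (fun z hz hzq => aux_even_closed hT w z hz P
        (fun F hF G hG h1 h2 h3 h4 h5 => hP F hF G hG z hz hzq h1 h3 h2 h4 h5)) hq
    have : ((T.filter fun F => w ∈ F ∧ P F).filter fun F => q ∈ F) = {G} := by
      ext K
      simp only [mem_filter, mem_singleton]
      constructor
      · rintro ⟨⟨h1, h2, h3⟩, h4⟩
        rcases hun K h1 h2 h4 with rfl | rfl
        · exact absurd h3 hnF
        · rfl
      · rintro rfl; exact ⟨⟨hG, hwG, hPG⟩, hqG⟩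
    rw [this] at hev
    simp at hev
  · obtain ⟨A, hA, hwA, hPA⟩ := hpT
    refine hnF (aux_star hT w P ?_ hA hF hwA hwF hPA)
    intro B hB C hC hwB hwC hBC hPB
    obtain ⟨z, hzw, hzB, hzC, _⟩ := aux_adj_pair w (mem_inter.2 ⟨hwB, hwC⟩) hBC
    by_cases hzq : z = q
    · subst hzq
      rcases hun B hB hwB hzB with rfl | rfl
      · exact absurd hPB hnF
      · exact absurd hPB hPG
    · exact hP B hB C hC z hzw hzq hwB hwC hzB hzC hPB

end Aux


section Nonsep
variable [DecidableEq V]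

theorem nonsep_step {T : Finset (Finset V)} (hT : IsTriangulation T) (C : Finset V)
    {A B : Finset V} (hA : A ∈ T) (hB : B ∈ T) {u z : V} (huz : u ≠ z) (h1 : u ∈ A) (h2 : z ∈ A)
    (h3 : u ∈ B) (h4 : z ∈ B) (hz : z ∉ C) :
    Relation.ReflTransGen (SeparatesRel T C) A B := by
  by_cases h : A = B
  · rw [h]
  · apply Relation.ReflTransGen.single
    have := aux_inter_card (hT.card_three A hA) (hT.card_three B hB) h huz h1 h2 h3 h4
    refine ⟨hA, hB, by rw [this, card_pair huz], fun hs => hz (hs ?_)⟩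
    simp [h2, h4]

theorem nonsep_symm {T : Finset (Finset V)} {C : Finset V} {A B : Finset V}
    (h : Relation.ReflTransGen (SeparatesRel T C) A B) :
    Relation.ReflTransGen (SeparatesRel T C) B A := by
  have : ∀ A B, SeparatesRel T C A B → SeparatesRel T C B A := by
    rintro A B ⟨h1, h2, h3, h4⟩
    refine ⟨h2, h1, ?_, ?_⟩ <;> rwa [inter_comm]
  induction h with
  | refl => exact .refl
  | tail _ h ih => exact .head (this _ _ h) ih

theorem nonsep_star {T : Finset (Finset V)} (hT : IsTriangulation T) (C : Finset V)
    {A B : Finset V} (hA : A ∈ T) (hB : B ∈ T) {w : V} (h1 : w ∈ A) (h2 : w ∈ B) (hw : w ∉ C) :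
    Relation.ReflTransGen (SeparatesRel T C) A B := by
  refine aux_star hT w (fun B => Relation.ReflTransGen (SeparatesRel T C) A B) ?_ hA hB h1 h2 .refl
  intro F hF G hG hwF hwG hFG h
  refine h.tail ⟨hF, hG, hFG, fun hs => hw (hs ?_)⟩
  simp [hwF, hwG]

theorem nonsep_core {T : Finset (Finset V)} (hT : IsTriangulation T) {v b e : V} (hvb : v ≠ b)
    (hbe : b ≠ e)
    {A : Finset V} (hA : A ∈ T) (hvbA : ∃ F ∈ T, v ∈ F ∧ b ∈ F)
    (hv : ∀ B ∈ T, v ∈ B → Relation.ReflTransGen (SeparatesRel T {v, b, e}) A B) :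
    Nonseparating T {v, b, e} := by
  have hall : ∀ B ∈ T, Relation.ReflTransGen (SeparatesRel T {v, b, e}) A B := by
    intro B hB
    refine aux_all hT (fun B => Relation.ReflTransGen (SeparatesRel T {v, b, e}) A B) ?_ hA hB .refl
    intro F hF G hG hFG h
    by_cases hs : F ∩ G ⊆ {v, b, e}
    · by_cases hvG : v ∈ G
      · exact hv G hG hvG
      · -- the common edge is `b e`
        have hsub : F ∩ G ⊆ {b, e} := by
          intro t ht
          have := hs ht
          simp only [mem_insert, mem_singleton] at this ⊢
          rcases this with rfl | h | h
          · exact absurd (mem_inter.1 ht).2 hvG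
          · exact Or.inl h
          · exact Or.inr h
        have heq : F ∩ G = {b, e} := eq_of_subset_of_card_le hsub (by rw [hFG, card_pair hbe])
        have hbG : b ∈ F ∩ G := by rw [heq]; simp
        have heG : e ∈ F ∩ G := by rw [heq]; simp
        simp only [mem_inter] at hbG heG
        obtain ⟨K, hK, hvK, hbK⟩ := hvbA
        refine aux_arc hT b e hbe.symm
          (fun B => Relation.ReflTransGen (SeparatesRel T {v, b, e}) A B) ?_
          ⟨K, hK, hbK, hv K hK hvK⟩ G hG hbG.2 heG.2
        intro X hX Y hY z hzb hze hbX hbY hzX hzY hAX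
        by_cases hzv : z = v
        · subst hzv; exact hv Y hY hzY
        · exact hAX.trans (nonsep_step hT _ hX hY hzb.symm hbX hzX hbY hzY (by simp [*]))
    · exact h.tail ⟨hF, hG, hFG, hs⟩
  intro B hB B' hB'
  exact (nonsep_symm (hall B hB)).trans (hall B' hB')

theorem nonsep_chord {T : Finset (Finset V)} (hT : IsTriangulation T) {v : V} {d : ℕ}
    {ℓ : ZMod d → V} (hℓ : IsLink T v d ℓ) {i k s t : ℕ} (hik : i < k) (hk : k < d)
    (his : i < s) (hsk : s < k) (ht : t < i ∨ k < t) (htd : t < d)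
    (hst : Adj T (ℓ s) (ℓ t)) : Nonseparating T {v, ℓ i, ℓ k} := by
  obtain ⟨hinj, hne, hfaces⟩ := hℓ
  have hd : d ≠ 0 := by omega
  have : NeZero d := ⟨hd⟩
  set C : Finset V := {v, ℓ i, ℓ k} with hC
  let F : ℕ → Finset V := fun m => {v, ℓ m, ℓ ((m : ZMod d) + 1)}
  have hF : ∀ m, F m ∈ T ∧ v ∈ F m := fun m => (hfaces _).2 ⟨m, rfl⟩
  have hF1 : ∀ m, ℓ (m : ZMod d) ∈ F m := fun m => by simp [F]
  have hF2 : ∀ m, ℓ ((m + 1 : ℕ) : ZMod d) ∈ F m := fun m => by simp [F]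
  have hcast : ∀ m n : ℕ, n < d → m < 2 * d → ((m : ZMod d) = n ↔ m = n ∨ m = n + d) := by
    intro m n hn hm
    rw [ZMod.natCast_eq_natCast_iff', Nat.mod_eq_of_lt hn]
    rcases lt_or_ge m d with h | h
    · rw [Nat.mod_eq_of_lt h]; omega
    · rw [Nat.mod_eq_sub_mod h, Nat.mod_eq_of_lt (by omega)]; omega
  have hnot : ∀ m : ℕ, m < 2 * d → m ≠ i → m ≠ k → m ≠ i + d → m ≠ k + d → ℓ m ∉ C := by
    intro m hm h1 h2 h3 h4 hmem
    simp only [hC, mem_insert, mem_singleton] at hmem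
    rcases hmem with h | h | h
    · exact hne _ h
    · have := (hcast m i (by omega) hm).1 (hinj h); omega
    · have := (hcast m k (by omega) hm).1 (hinj h); omega
  have hstep : ∀ m : ℕ, m + 1 < 2 * d → m + 1 ≠ i → m + 1 ≠ k → m + 1 ≠ i + d → m + 1 ≠ k + d →
      Relation.ReflTransGen (SeparatesRel T C) (F m) (F (m + 1)) := by
    intro m hm h1 h2 h3 h4
    exact nonsep_step hT C (hF m).1 (hF (m + 1)).1 (hne _).symm (hF m).2 (hF2 m) (hF _).2 (hF1 _)
      (hnot _ hm h1 h2 h3 h4)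
  have arc1 : ∀ m, i ≤ m → m < k → Relation.ReflTransGen (SeparatesRel T C) (F i) (F m) := by
    intro m him
    induction m, him using Nat.le_induction with
    | base => intro _; exact .refl
    | succ n hn ih =>
      intro h
      exact (ih (by omega)).trans (hstep n (by omega) (by omega) (by omega) (by omega) (by omega))
  have arc2 : ∀ m, k ≤ m → m < i + d → Relation.ReflTransGen (SeparatesRel T C) (F k) (F m) := by
    intro m him
    induction m, him using Nat.le_induction with
    | base => intro _; exact .refl
    | succ n hn ih =>
      intro h
      exact (ih (by omega)).trans (hstep n (by omega) (by omega) (by omega) (by omega) (by omega))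
  have hper : ∀ m, F (m + d) = F m := by intro m; simp [F]
  -- the crossing edge joins the two arcs
  have hcross : Relation.ReflTransGen (SeparatesRel T C) (F i) (F k) := by
    obtain ⟨hne', G, hG, hsub⟩ := hst
    have hsG : ℓ s ∈ G := hsub (by simp)
    have htG : ℓ t ∈ G := hsub (by simp)
    have e1 := arc1 s (by omega) hsk
    have e2 : Relation.ReflTransGen (SeparatesRel T C) (F s) G :=
      nonsep_star hT C (hF s).1 hG (hF1 s) hsG
        (hnot s (by omega) (by omega) (by omega) (by omega) (by omega))
    have e3 : Relation.ReflTransGen (SeparatesRel T C) G (F t) :=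
      nonsep_star hT C hG (hF t).1 htG (hF1 t)
        (hnot t (by omega) (by omega) (by omega) (by omega) (by omega))
    have e4 : Relation.ReflTransGen (SeparatesRel T C) (F k) (F t) := by
      rcases ht with h | h
      · rw [← hper t]; exact arc2 _ (by omega) (by omega)
      · exact arc2 _ (by omega) (by omega)
    exact ((e1.trans e2).trans e3).trans (nonsep_symm e4)
  have hik' : ℓ (i : ZMod d) ≠ ℓ (k : ZMod d) := by
    intro h
    have := (hcast i k hk (by omega)).1 (hinj h); omega
  refine nonsep_core hT (hne _).symm hik' (hF i).1 ⟨F i, (hF i).1, (hF i).2, hF1 i⟩ ?_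
  intro B hB hvB
  obtain ⟨m, hm⟩ := (hfaces B).1 ⟨hB, hvB⟩
  have hB' : B = F m.val := by rw [hm]; simp [F]
  have hmd := ZMod.val_lt m
  rw [hB']
  rcases lt_or_ge m.val i with h | h
  · rw [← hper m.val]; exact hcross.trans (arc2 _ (by omega) (by omega))
  · rcases lt_or_ge m.val k with h' | h'
    · exact arc1 _ h h'
    · exact hcross.trans (arc2 _ h' (by omega))

/-- If every link vertex lies on a nonfacial 3-cycle through `v`, the conclusion holds. -/
theorem chords_cross {T : Finset (Finset V)} (hT : IsTriangulation T) {v : V}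
    (hv : v ∈ vertexSet T) {d : ℕ}
    {ℓ : ZMod d → V} (hℓ : IsLink T v d ℓ)
    (hnf : ∀ u, Adj T v u → ∃ z, z ≠ v ∧ z ≠ u ∧ Adj T v z ∧ Adj T u z ∧ {v, u, z} ∉ T) :
    ∃ i j k l : ℕ, i < j ∧ j < k ∧ k < l ∧ l < d ∧
      IsTriCycle T {v, ℓ (i : ZMod d), ℓ (k : ZMod d)} ∧
      Nonseparating T {v, ℓ (i : ZMod d), ℓ (k : ZMod d)} ∧
      IsTriCycle T {v, ℓ (j : ZMod d), ℓ (l : ZMod d)} ∧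
      Nonseparating T {v, ℓ (j : ZMod d), ℓ (l : ZMod d)} := by
  have hℓ' := hℓ
  obtain ⟨hinj, hne, hfaces⟩ := hℓ
  have hadj : ∀ m, Adj T v (ℓ m) := by
    intro m
    obtain ⟨h1, h2⟩ := (hfaces _).2 ⟨m, rfl⟩
    refine ⟨(hne m).symm, _, h1, ?_⟩
    intro t; simp; tauto
  have hd : d ≠ 0 := by
    rintro rfl
    have : Function.Injective (fun m : ℤ => (⟨ℓ m, by
      obtain ⟨-, F, hF, hs⟩ := hadj m
      simp only [vertexSet, mem_biUnion, id]
      exact ⟨F, hF, hs (by simp)⟩⟩ : vertexSet T)) := by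
      intro m n h
      simp only [Subtype.mk.injEq] at h
      exact hinj h
    exact not_injective_infinite_finite _ this
  have : NeZero d := ⟨hd⟩
  let ch : ℕ → ℕ → Prop := fun m n => m < d ∧ n < d ∧ Adj T (ℓ m) (ℓ n) ∧ {v, ℓ m, ℓ n} ∉ T
  have ch_symm : ∀ m n, ch m n → ch n m := by
    rintro m n ⟨h1, h2, ⟨h3, F, hF, hs⟩, h4⟩
    refine ⟨h2, h1, ⟨h3.symm, F, hF, by rwa [pair_comm]⟩, by rwa [pair_comm (ℓ n)]⟩
  have ch_ne : ∀ m n, ch m n → m ≠ n ∧ m ≠ n + 1 ∧ n ≠ m + 1 := by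
    have : ∀ m n, ch m n → m ≠ n ∧ n ≠ m + 1 := by
      rintro m n ⟨h1, h2, ⟨h3, -⟩, h4⟩
      refine ⟨by rintro rfl; exact h3 rfl, ?_⟩
      rintro rfl
      apply h4
      have := ((hfaces {v, ℓ m, ℓ ((m : ZMod d) + 1)}).2 ⟨m, rfl⟩).1
      push_cast
      exact this
    intro m n h
    exact ⟨(this m n h).1, (this n m (ch_symm m n h)).2, (this m n h).2⟩
  have ch_ex : ∀ m, m < d → ∃ n, ch m n := by
    intro m hm
    obtain ⟨z, hzv, hzu, ⟨-, F, hF, hs⟩, h2, h3⟩ := hnf _ (hadj m)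
    obtain ⟨n, hn⟩ := (hfaces F).1 ⟨hF, hs (by simp)⟩
    have hzF : z ∈ F := hs (by simp)
    have : ∃ n : ZMod d, z = ℓ n := by
      rw [hn] at hzF
      simp only [mem_insert, mem_singleton] at hzF
      rcases hzF with h | h | h
      · exact absurd h hzv
      · exact ⟨_, h⟩
      · exact ⟨_, h⟩
    obtain ⟨n', rfl⟩ := this
    refine ⟨n'.val, hm, ZMod.val_lt _, ?_, ?_⟩ <;> simpa using by assumption
  have hcyc : ∀ m n, ch m n → IsTriCycle T {v, ℓ m, ℓ n} := by
    rintro m n ⟨h1, h2, h3, -⟩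
    have hedge : ∀ a b, Adj T a b → ({a, b} : Finset V) ∈ edgeSet T := by
      rintro a b ⟨hab, F, hF, hs⟩
      simp only [edgeSet, mem_filter, mem_powersetCard]
      refine ⟨⟨?_, card_pair hab⟩, F, hF, hs⟩
      intro t ht
      simp only [vertexSet, mem_biUnion, id]
      exact ⟨F, hF, hs ht⟩
    refine ⟨aux_card_three (hne _).symm (hne _).symm h3.1, ?_⟩
    intro e he
    rw [mem_powersetCard, card_eq_two] at he
    obtain ⟨hsub, p, q, hpq, rfl⟩ := he
    have hp := hsub (mem_insert_self p {q})
    have hq := hsub (mem_insert_of_mem (mem_singleton_self q))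
    simp only [mem_insert, mem_singleton] at hp hq
    have e1 := hedge _ _ (hadj m)
    have e2 := hedge _ _ (hadj n)
    have e3 := hedge _ _ h3
    rcases hp with rfl | rfl | rfl <;> rcases hq with rfl | rfl | rfl <;>
      first
        | exact absurd rfl hpq
        | assumption
        | (rw [pair_comm]; assumption)
  -- shortest chord
  have hex : ∃ n, ∃ i, ch i (i + n) := by
    obtain ⟨n, hn⟩ := ch_ex 0 (by omega)
    exact ⟨n, 0, by simpa using hn⟩
  obtain ⟨i, hi⟩ := Nat.find_spec hex
  have hmin : ∀ m n, m ≤ n → ch m n → Nat.find hex ≤ n - m := by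
    intro m n hmn h
    exact Nat.find_min' hex ⟨m, by rwa [Nat.add_sub_cancel' hmn]⟩
  generalize Nat.find hex = N at hi hmin
  have h1 := ch_ne _ _ hi
  have h1d : i + N < d := hi.2.1
  obtain ⟨m, hm⟩ := ch_ex (i + 1) (by omega)
  have h2 := ch_ne _ _ hm
  have hmd : m < d := hm.2.1
  have hcase : m < i ∨ i + N < m := by
    by_contra hcon
    push Not at hcon
    have := hmin (i + 1) m (by omega) hm
    omega
  rcases hcase with h | h
  · have hm' := ch_symm _ _ hm
    refine ⟨m, i, i + 1, i + N, h, by omega, by omega, h1d, hcyc _ _ hm', ?_, hcyc _ _ hi, ?_⟩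
    · exact nonsep_chord hT hℓ' (by omega) (by omega) h (by omega) (Or.inr (by omega)) h1d hi.2.2.1
    · exact nonsep_chord hT hℓ' (by omega) (by omega) (by omega) (by omega) (Or.inl h) hmd hm.2.2.1
  · refine ⟨i, i + 1, i + N, m, by omega, by omega, h, hmd, hcyc _ _ hi, ?_, hcyc _ _ hm, ?_⟩
    · exact nonsep_chord hT hℓ' (by omega) (by omega) (by omega) (by omega) (Or.inr h) hmd hm.2.2.1
    · exact nonsep_chord hT hℓ' (by omega) (by omega) (by omega) (by omega) (Or.inl (by omega))
        (by omega) (ch_symm _ _ hi).2.2.1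

end Nonsep


section Contr
variable [DecidableEq V]

/-- The edge `ac` lies on the faces `acx`, `acy` and on no nonfacial 3-cycle, and the two
remaining triangles on `xy` are not both faces. -/
structure ContrData (T : Finset (Finset V)) (a c x y : V) : Prop where
  tri : IsTriangulation T
  hac : a ≠ c
  hax : a ≠ x
  hay : a ≠ y
  hcx : c ≠ x
  hcy : c ≠ y
  hxy : x ≠ y
  fx : {a, c, x} ∈ T
  fy : {a, c, y} ∈ T
  common : ∀ z, ∀ F ∈ T, ∀ G ∈ T, a ∈ F → z ∈ F → c ∈ G → z ∈ G → z ≠ a → z ≠ c → z = x ∨ z = y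
  nk4 : ¬ ({a, x, y} ∈ T ∧ {c, x, y} ∈ T)

theorem ContrData.symm {T : Finset (Finset V)} {a c x y : V} (h : ContrData T a c x y) :
    ContrData T c a x y where
  tri := h.tri
  hac := h.hac.symm
  hax := h.hcx
  hay := h.hcy
  hcx := h.hax
  hcy := h.hay
  hxy := h.hxy
  fx := by rw [insert_comm]; exact h.fx
  fy := by rw [insert_comm]; exact h.fy
  common := fun z F hF G hG h1 h2 h3 h4 h5 h6 => h.common z G hG F hF h3 h4 h1 h2 h6 h5
  nk4 := fun hh => h.nk4 hh.symm

theorem ContrData.swap {T : Finset (Finset V)} {a c x y : V} (h : ContrData T a c x y) :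
    ContrData T a c y x where
  tri := h.tri
  hac := h.hac
  hax := h.hay
  hay := h.hax
  hcx := h.hcy
  hcy := h.hcx
  hxy := h.hxy.symm
  fx := h.fy
  fy := h.fx
  common := fun z F hF G hG h1 h2 h3 h4 h5 h6 =>
    (h.common z F hF G hG h1 h2 h3 h4 h5 h6).symm
  nk4 := fun hh => h.nk4 ⟨by rw [pair_comm]; exact hh.1, by rw [pair_comm]; exact hh.2⟩

/-- The vertex map of the contraction. -/
def cmap (a c : V) : V → V := fun x => if x = c then a else x

theorem contract_eq (T : Finset (Finset V)) (a c : V) :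
    contract T a c = (T.filter fun F => ¬ (a ∈ F ∧ c ∈ F)).image (Finset.image (cmap a c)) := rfl

theorem mem_cmap {a c u : V} (hac : a ≠ c) (F : Finset V) :
    u ∈ F.image (cmap a c) ↔ (u ≠ c ∧ u ∈ F) ∨ (u = a ∧ c ∈ F) := by
  simp only [mem_image, cmap]
  constructor
  · rintro ⟨z, hz, rfl⟩
    by_cases h : z = c
    · subst h; simp [hz]
    · simp [h, hz]
  · rintro (⟨h1, h2⟩ | ⟨rfl, h2⟩)
    · exact ⟨u, h2, by simp [h1]⟩
    · exact ⟨c, h2, by simp⟩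

theorem mem_cmap_of {a c u : V} (hac : a ≠ c) {F : Finset V} (h1 : u ≠ c) (h2 : u ∈ F) :
    u ∈ F.image (cmap a c) := (mem_cmap hac F).2 (Or.inl ⟨h1, h2⟩)

theorem mem_cmap_c {a c : V} (hac : a ≠ c) {F : Finset V} (h2 : c ∈ F) :
    a ∈ F.image (cmap a c) := (mem_cmap hac F).2 (Or.inr ⟨rfl, h2⟩)

theorem cmap_injOn {a c : V} {F : Finset V} (hF : ¬ (a ∈ F ∧ c ∈ F)) :
    Set.InjOn (cmap a c) F := by
  intro z hz z' hz' h
  simp only [cmap] at h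
  split_ifs at h with h1 h2 h2
  · rw [h1, h2]
  · subst h1 h; exact absurd ⟨hz', hz⟩ hF
  · subst h2 h; exact absurd ⟨hz, hz'⟩ hF
  · exact h

variable {T : Finset (Finset V)} {a c x y : V}

theorem ContrData.dead (h : ContrData T a c x y) {F : Finset V} (hF : F ∈ T) (ha : a ∈ F)
    (hc : c ∈ F) : F = {a, c, x} ∨ F = {a, c, y} := by
  obtain ⟨p, hpa, hpc, rfl⟩ := aux_third (h.tri.card_three F hF) h.hac ha hc
  rcases h.common p _ hF _ hF ha (by simp) hc (by simp) hpa hpc with rfl | rfl <;> simp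

theorem ContrData.inj (h : ContrData T a c x y) {F G : Finset V} (hF : F ∈ T) (hG : G ∈ T)
    (sF : ¬ (a ∈ F ∧ c ∈ F)) (sG : ¬ (a ∈ G ∧ c ∈ G))
    (he : F.image (cmap a c) = G.image (cmap a c)) : F = G := by
  have key : ∀ F ∈ T, ∀ G ∈ T, ¬ (a ∈ F ∧ c ∈ F) → ¬ (a ∈ G ∧ c ∈ G) →
      F.image (cmap a c) = G.image (cmap a c) → c ∈ F → c ∈ G := by
    intro F hF G hG sF sG he hcF
    by_contra hcG
    have hm : ∀ u, ((u ≠ c ∧ u ∈ F) ∨ (u = a ∧ c ∈ F)) ↔ ((u ≠ c ∧ u ∈ G) ∨ (u = a ∧ c ∈ G)) := by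
      intro u; rw [← mem_cmap h.hac, ← mem_cmap h.hac, he]
    have haG : a ∈ G := by have := hm a; grind
    have hfc := h.tri.card_three F hF
    have hgc := h.tri.card_three G hG
    have haF : a ∉ F := fun hh => sF ⟨hh, hcF⟩
    have h1 : ∀ u ∈ F, u ≠ c → u = x ∨ u = y := by
      intro u hu huc
      have hua : u ≠ a := by rintro rfl; exact haF hu
      have huG : u ∈ G := by have := hm u; grind
      exact h.common u G hG F hF haG huG hcF hu hua huc
    have h2 : F ⊆ {c, x, y} := by
      intro u hu
      by_cases huc : u = c
      · simp [huc]
      · have := h1 u hu huc; simp [this]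
    have h3 : F = {c, x, y} := by
      apply eq_of_subset_of_card_le h2
      rw [hfc, aux_card_three h.hcx h.hcy h.hxy]
    have hxG : x ∈ G := by
      have := hm x; have := h.hcx; have := h.hax; grind
    have hyG : y ∈ G := by
      have := hm y; have := h.hcy; have := h.hay; grind
    have h4 := aux_eq_of_three hgc h.hax h.hay h.hxy haG hxG hyG
    exact h.nk4 ⟨h4 ▸ hG, h3 ▸ hF⟩
  have h1 := key F hF G hG sF sG he
  have h2 := key G hG F hF sG sF he.symm
  ext u
  have hm : ((u ≠ c ∧ u ∈ F) ∨ (u = a ∧ c ∈ F)) ↔ ((u ≠ c ∧ u ∈ G) ∨ (u = a ∧ c ∈ G)) := by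
    rw [← mem_cmap h.hac, ← mem_cmap h.hac, he]
  by_cases huc : u = c
  · subst huc; exact ⟨h1, h2⟩
  · by_cases hua : u = a
    · subst hua; grind
    · simpa [huc, hua] using hm

theorem ContrData.nbr (h : ContrData T a c x y) :
    ∃ G ∈ T, a ∈ G ∧ x ∈ G ∧ c ∉ G ∧ ∀ K ∈ T, a ∈ K → x ∈ K → c ∉ K → K = G := by
  obtain ⟨G, hG, hne, haG, hxG, hun⟩ := aux_other h.tri h.hax h.fx (by simp) (by simp)
  refine ⟨G, hG, haG, hxG, ?_, ?_⟩
  · intro hcG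
    exact hne (aux_eq_of_three (h.tri.card_three G hG) h.hac h.hax h.hcx haG hcG hxG)
  · intro K hK h1 h2 h3
    rcases hun K hK h1 h2 with rfl | rfl
    · simp at h3
    · rfl

theorem ContrData.mem_contract (h : ContrData T a c x y) {F' : Finset V} :
    F' ∈ contract T a c ↔ ∃ F ∈ T, ¬ (a ∈ F ∧ c ∈ F) ∧ F.image (cmap a c) = F' := by
  rw [contract_eq]; simp only [mem_image, mem_filter, and_assoc]

theorem ContrData.card3 (h : ContrData T a c x y) {F : Finset V} (hF : F ∈ T)
    (sF : ¬ (a ∈ F ∧ c ∈ F)) : (F.image (cmap a c)).card = 3 := by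
  rw [card_image_of_injOn (cmap_injOn sF), h.tri.card_three F hF]

theorem ContrData.edge_two (h : ContrData T a c x y) (e : Finset V) (he : e.card = 2)
    (hex : ∃ F ∈ contract T a c, e ⊆ F) :
    ((contract T a c).filter fun F => e ⊆ F).card = 2 := by
  have h1 : ((contract T a c).filter fun F => e ⊆ F) =
      (T.filter fun F => ¬ (a ∈ F ∧ c ∈ F) ∧ e ⊆ F.image (cmap a c)).image
        (Finset.image (cmap a c)) := by
    ext F'
    simp only [mem_filter, mem_image, h.mem_contract]
    constructor
    · rintro ⟨⟨F, hF, sF, rfl⟩, h2⟩; exact ⟨F, ⟨hF, sF, h2⟩, rfl⟩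
    · rintro ⟨F, ⟨hF, sF, h2⟩, rfl⟩; exact ⟨⟨F, hF, sF, rfl⟩, h2⟩
  rw [h1, card_image_of_injOn]
  swap
  · intro F hF G hG hFG
    simp only [coe_filter, Set.mem_ofPred_eq] at hF hG
    exact h.inj hF.1 hG.1 hF.2.1 hG.2.1 hFG
  obtain ⟨F', hF', heF'⟩ := hex
  obtain ⟨F, hF, sF, rfl⟩ := h.mem_contract.1 hF'
  have hce : c ∉ e := by
    intro hc
    have := (mem_cmap h.hac F).1 (heF' hc)
    rcases this with ⟨h1, _⟩ | ⟨h1, _⟩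
    · exact h1 rfl
    · exact h.hac h1.symm
  by_cases hae : a ∈ e
  · obtain ⟨z, hza, rfl⟩ : ∃ z, z ≠ a ∧ e = {a, z} := by
      rw [card_eq_two] at he
      obtain ⟨p, q, hpq, rfl⟩ := he
      simp only [mem_insert, mem_singleton] at hae
      rcases hae with rfl | rfl
      · exact ⟨q, hpq.symm, rfl⟩
      · exact ⟨p, hpq, pair_comm _ _⟩
    have hzc : z ≠ c := by rintro rfl; simp at hce
    have hsub : ∀ K : Finset V, {a, z} ⊆ K.image (cmap a c) ↔ (a ∈ K ∨ c ∈ K) ∧ z ∈ K := by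
      intro K
      rw [insert_subset_iff, singleton_subset_iff, mem_cmap h.hac, mem_cmap h.hac]
      have := h.hac
      simp [hzc, hza, this]
    rw [hsub] at heF'
    simp only [hsub]
    -- general treatment of a vertex of type `x`
    have gen : ∀ x y, ContrData T a c x y →
        (T.filter fun F => ¬ (a ∈ F ∧ c ∈ F) ∧ (a ∈ F ∨ c ∈ F) ∧ x ∈ F).card = 2 := by
      intro x y h
      obtain ⟨G, hG, haG, hxG, hcG, hun⟩ := h.nbr
      obtain ⟨G', hG', hcG', hxG', haG', hun'⟩ := h.symm.nbr
      rw [card_eq_two]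
      refine ⟨G, G', by rintro rfl; exact hcG hcG', ?_⟩
      ext K
      simp only [mem_filter, mem_insert, mem_singleton]
      constructor
      · rintro ⟨hK, hs, hac, hx⟩
        rcases hac with h1 | h1
        · exact Or.inl (hun K hK h1 hx (fun h2 => hs ⟨h1, h2⟩))
        · exact Or.inr (hun' K hK h1 hx (fun h2 => hs ⟨h2, h1⟩))
      · rintro (rfl | rfl)
        · exact ⟨hG, by tauto, Or.inl haG, hxG⟩
        · exact ⟨hG', by tauto, Or.inr hcG', hxG'⟩
    by_cases hzx : z = x
    · subst hzx; exact gen z y h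
    by_cases hzy : z = y
    · subst hzy; exact gen z x h.swap
    obtain ⟨hac', hzF⟩ := heF'
    rcases hac' with haF | hcF
    · rw [← h.tri.edge_two_faces {a, z} (card_pair hza.symm)
        ⟨F, hF, by simp [insert_subset_iff, haF, hzF]⟩]
      congr 1
      ext K
      simp only [mem_filter, insert_subset_iff, singleton_subset_iff]
      constructor
      · rintro ⟨hK, hs, h1 | h1, h2⟩
        · exact ⟨hK, h1, h2⟩
        · have := h.common z F hF K hK haF hzF h1 h2 hza hzc; tauto
      · rintro ⟨hK, h1, h2⟩
        refine ⟨hK, ?_, Or.inl h1, h2⟩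
        rintro ⟨-, h3⟩
        have := h.common z F hF K hK haF hzF h3 h2 hza hzc; tauto
    · rw [← h.tri.edge_two_faces {c, z} (card_pair hzc.symm)
        ⟨F, hF, by simp [insert_subset_iff, hcF, hzF]⟩]
      congr 1
      ext K
      simp only [mem_filter, insert_subset_iff, singleton_subset_iff]
      constructor
      · rintro ⟨hK, hs, h1 | h1, h2⟩
        · have := h.common z K hK F hF h1 h2 hcF hzF hza hzc; tauto
        · exact ⟨hK, h1, h2⟩
      · rintro ⟨hK, h1, h2⟩
        refine ⟨hK, ?_, Or.inr h1, h2⟩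
        rintro ⟨h3, -⟩
        have := h.common z K hK F hF h3 h2 hcF hzF hza hzc; tauto
  · have hsub : ∀ K : Finset V, e ⊆ K.image (cmap a c) ↔ e ⊆ K := by
      intro K
      constructor
      · intro hs u hu
        rcases (mem_cmap h.hac K).1 (hs hu) with h1 | h1
        · exact h1.2
        · exact absurd (h1.1 ▸ hu) hae
      · intro hs u hu
        exact (mem_cmap h.hac K).2 (Or.inl ⟨by rintro rfl; exact hce hu, hs hu⟩)
    rw [hsub] at heF'
    rw [← h.tri.edge_two_faces e he ⟨F, hF, heF'⟩]
    congr 1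
    ext K
    simp only [mem_filter, hsub]
    constructor
    · rintro ⟨h1, -, h2⟩; exact ⟨h1, h2⟩
    · rintro ⟨h1, h2⟩
      refine ⟨h1, ?_, h2⟩
      rintro ⟨h3, h4⟩
      have : insert a (insert c e) ⊆ K := by
        simp [insert_subset_iff, h3, h4, h2]
      have h5 := card_le_card this
      rw [card_insert_of_notMem (by simp [hae, h.hac]), card_insert_of_notMem hce, he,
        h.tri.card_three K h1] at h5
      omega

/-- The surviving faces at `a` form a connected arc. -/
theorem ContrData.arc (h : ContrData T a c x y) (P : Finset V → Prop)
    (hP : ∀ F ∈ T, ∀ G ∈ T, ∀ z, z ≠ a → z ≠ x → z ≠ y → c ∉ F → c ∉ G → a ∈ F → a ∈ G →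
      z ∈ F → z ∈ G → P F → P G)
    {F G : Finset V} (hF : F ∈ T) (hG : G ∈ T) (haF : a ∈ F) (haG : a ∈ G)
    (hcF : c ∉ F) (hcG : c ∉ G) (hPF : P F) : P G := by
  -- every face on `a x` (not dead) satisfies `P`
  have gen : ∀ x y, ContrData T a c x y → (∀ F ∈ T, ∀ G ∈ T, ∀ z, z ≠ a → z ≠ x → z ≠ y →
      c ∉ F → c ∉ G → a ∈ F → a ∈ G → z ∈ F → z ∈ G → P F → P G) →
      ∀ K ∈ T, a ∈ K → x ∈ K → c ∉ K → P K := by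
    intro x y h hP K hK haK hxK hcK
    by_contra hnP
    obtain ⟨N, hN, haN, hxN, hcN, hun⟩ := h.nbr
    have hKN := hun K hK haK hxK hcK
    subst hKN
    have := aux_arc h.tri a y h.hay.symm (fun F => c ∉ F ∧ P F) (by
      intro A hA B hB z hza hzy haA haB hzA hzB hPA
      by_cases hzx : z = x
      · subst hzx
        exact absurd (hun A hA haA hzA hPA.1 ▸ hPA.2) hnP
      · have hcB : c ∉ B := by
          intro hcB
          have hzc : z ≠ c := by rintro rfl; exact hPA.1 hzA
          have := h.common z A hA B hB haA hzA hcB hzB hza hzc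
          tauto
        exact ⟨hcB, hP A hA B hB z hza hzx hzy hPA.1 hcB haA haB hzA hzB hPA.2⟩)
      ⟨F, hF, haF, hcF, hPF⟩ _ h.fy (by simp) (by simp)
    simp at this
  have hx := gen x y h hP
  have hy := gen y x h.swap (fun F hF G hG z h1 h2 h3 => hP F hF G hG z h1 h3 h2)
  have := aux_star h.tri a (fun F => c ∉ F → P F) (by
    intro A hA B hB haA haB hAB hPA hcB
    obtain ⟨z, hza, hzA, hzB, -⟩ := aux_adj_pair a (mem_inter.2 ⟨haA, haB⟩) hAB
    by_cases hzx : z = x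
    · subst hzx; exact hx B hB haB hzB hcB
    by_cases hzy : z = y
    · subst hzy; exact hy B hB haB hzB hcB
    have hcA : c ∉ A := by
      intro hcA
      have hzc : z ≠ c := by rintro rfl; exact hcB hzB
      have := h.common z B hB A hA haB hzB hcA hzA hza hzc
      tauto
    exact hP A hA B hB z hza hzx hzy hcA hcB haA haB hzA hzB (hPA hcA))
    hF hG haF haG (fun _ => hPF)
  exact this hcG

theorem ContrData.link_step (h : ContrData T a c x y) {F G : Finset V} (hF : F ∈ T) (hG : G ∈ T)
    (sF : ¬ (a ∈ F ∧ c ∈ F)) (sG : ¬ (a ∈ G ∧ c ∈ G)) {w z : V} (hwz : w ≠ z)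
    (h1 : w ∈ F.image (cmap a c)) (h2 : z ∈ F.image (cmap a c))
    (h3 : w ∈ G.image (cmap a c)) (h4 : z ∈ G.image (cmap a c)) :
    Relation.ReflTransGen (LinkAdj (contract T a c) w)
      (F.image (cmap a c)) (G.image (cmap a c)) := by
  by_cases he : F.image (cmap a c) = G.image (cmap a c)
  · rw [he]
  · apply Relation.ReflTransGen.single
    have := aux_inter_card (h.card3 hF sF) (h.card3 hG sG) he hwz h1 h2 h3 h4
    exact ⟨h.mem_contract.2 ⟨F, hF, sF, rfl⟩, h.mem_contract.2 ⟨G, hG, sG, rfl⟩,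
      mem_inter.2 ⟨h1, h3⟩, by rw [this, card_pair hwz]⟩

theorem ContrData.link_conn (h : ContrData T a c x y) (w : V) (F' : Finset V)
    (hF' : F' ∈ contract T a c) (G' : Finset V) (hG' : G' ∈ contract T a c)
    (hwF : w ∈ F') (hwG : w ∈ G') :
    Relation.ReflTransGen (LinkAdj (contract T a c) w) F' G' := by
  obtain ⟨F, hF, sF, rfl⟩ := h.mem_contract.1 hF'
  obtain ⟨G, hG, sG, rfl⟩ := h.mem_contract.1 hG'
  have hac := h.hac
  set R := Relation.ReflTransGen (LinkAdj (contract T a c) w) (F.image (cmap a c)) with hR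
  by_cases hwa : w = a
  · subst hwa
    obtain ⟨N, hN, haN, hxN, hcN, hun⟩ := h.nbr
    obtain ⟨N', hN', hcN', hxN', haN', hun'⟩ := h.symm.nbr
    have hPa : ∀ K ∈ T, ∀ L ∈ T, w ∈ K → w ∈ L → c ∉ K → c ∉ L →
        R (K.image (cmap w c)) → R (L.image (cmap w c)) := by
      intro K hK L hL haK haL hcK hcL
      refine h.arc (fun K => R (K.image (cmap w c))) ?_ hK hL haK haL hcK hcL
      intro A hA B hB z hza _ _ hcA hcB haA haB hzA hzB hRA
      have hzc : z ≠ c := by rintro rfl; exact hcA hzA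
      exact hRA.trans (h.link_step hA hB (fun hh => hcA hh.2) (fun hh => hcB hh.2) hza.symm
        (mem_cmap_of hac hac haA) (mem_cmap_of hac hzc hzA) (mem_cmap_of hac hac haB)
        (mem_cmap_of hac hzc hzB))
    have hPc : ∀ K ∈ T, ∀ L ∈ T, c ∈ K → c ∈ L → w ∉ K → w ∉ L →
        R (K.image (cmap w c)) → R (L.image (cmap w c)) := by
      intro K hK L hL haK haL hcK hcL
      refine h.symm.arc (fun K => R (K.image (cmap w c))) ?_ hK hL haK haL hcK hcL
      intro A hA B hB z hzc _ _ hcA hcB haA haB hzA hzB hRA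
      have hza : z ≠ w := by rintro rfl; exact hcA hzA
      exact hRA.trans (h.link_step hA hB (fun hh => hcA hh.1) (fun hh => hcB hh.1) hza.symm
        (mem_cmap_c hac haA) (mem_cmap_of hac hzc hzA) (mem_cmap_c hac haB)
        (mem_cmap_of hac hzc hzB))
    have m1 : w ∈ N.image (cmap w c) := mem_cmap_of hac hac haN
    have m2 : x ∈ N.image (cmap w c) := mem_cmap_of hac h.hcx.symm hxN
    have m3 : w ∈ N'.image (cmap w c) := mem_cmap_c hac hcN'
    have m4 : x ∈ N'.image (cmap w c) := mem_cmap_of hac h.hcx.symm hxN'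
    have s1 : ¬ (w ∈ N ∧ c ∈ N) := fun hh => hcN hh.2
    have s2 : ¬ (w ∈ N' ∧ c ∈ N') := fun hh => haN' hh.1
    have e1 : R (N.image (cmap w c)) → R (N'.image (cmap w c)) := fun hh =>
      hh.trans (h.link_step hN hN' s1 s2 h.hax m1 m2 m3 m4)
    have e2 : R (N'.image (cmap w c)) → R (N.image (cmap w c)) := fun hh =>
      hh.trans (h.link_step hN' hN s2 s1 h.hax m3 m4 m1 m2)
    have hFF : R (F.image (cmap w c)) := .refl
    rw [mem_cmap hac] at hwF hwG
    have cF : (w ∈ F ∧ c ∉ F) ∨ (c ∈ F ∧ w ∉ F) := by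
      clear hPa hPc e1 e2 hR; grind
    have cG : (w ∈ G ∧ c ∉ G) ∨ (c ∈ G ∧ w ∉ G) := by
      clear hPa hPc e1 e2 hR; grind
    have both : R (N.image (cmap w c)) ∧ R (N'.image (cmap w c)) := by
      rcases cF with ⟨h1, h2⟩ | ⟨h1, h2⟩
      · have := hPa F hF N hN h1 haN h2 hcN hFF
        exact ⟨this, e1 this⟩
      · have := hPc F hF N' hN' h1 hcN' h2 haN' hFF
        exact ⟨e2 this, this⟩
    rcases cG with ⟨h1, h2⟩ | ⟨h1, h2⟩
    · exact hPa N hN G hG haN h1 hcN h2 both.1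
    · exact hPc N' hN' G hG hcN' h1 haN' h2 both.2
  · rw [mem_cmap hac] at hwF hwG
    have hwF' : w ∈ F := by
      rcases hwF with h1 | h1
      · exact h1.2
      · exact absurd h1.1 hwa
    have hwG' : w ∈ G := by
      rcases hwG with h1 | h1
      · exact h1.2
      · exact absurd h1.1 hwa
    have hwc : w ≠ c := by
      rcases hwG with h1 | h1
      · exact h1.1
      · exact absurd h1.1 hwa
    have := aux_star h.tri w (fun H => ∀ K ∈ T, ¬ (a ∈ K ∧ c ∈ K) → w ∈ K →
        (K = H ∨ ((a ∈ H ∧ c ∈ H) ∧ (a ∈ K ∨ c ∈ K))) → R (K.image (cmap a c))) (by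
      intro A hA B hB hwA hwB hAB hPA K hK sK hwK hKB
      obtain ⟨z, hzw, hzA, hzB, -⟩ := aux_adj_pair w (mem_inter.2 ⟨hwA, hwB⟩) hAB
      by_cases sA : a ∈ A ∧ c ∈ A
      · rcases hKB with rfl | ⟨hB1, hB2⟩
        · by_cases hz : z = a ∨ z = c
          · exact hPA K hK sK hwK (Or.inr ⟨sA, by
              rcases hz with rfl | rfl
              · exact Or.inl hzB
              · exact Or.inr hzB⟩)
          · -- impossible: `A = {a, c, w}` and `z ∈ A`
            exfalso
            have := aux_eq_of_three (h.tri.card_three A hA) hac (Ne.symm hwa) (Ne.symm hwc)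
              sA.1 sA.2 hwA
            rw [this] at hzA
            simp only [mem_insert, mem_singleton] at hzA
            rcases hzA with h1 | h1 | h1
            · exact hz (Or.inl h1)
            · exact hz (Or.inr h1)
            · exact hzw h1
        · exact hPA K hK sK hwK (Or.inr ⟨sA, hB2⟩)
      · have hRA := hPA A hA sA hwA (Or.inl rfl)
        have mA : w ∈ A.image (cmap a c) := mem_cmap_of hac hwc hwA
        have mK : w ∈ K.image (cmap a c) := mem_cmap_of hac hwc hwK
        rcases hKB with rfl | ⟨hB1, hB2⟩
        · refine hRA.trans (h.link_step hA hK sA sK (z := cmap a c z) ?_ mA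
            (mem_image_of_mem _ hzA) mK (mem_image_of_mem _ hzB))
          simp only [cmap]
          split_ifs
          · exact hwa
          · exact hzw.symm
        · have hBe := aux_eq_of_three (h.tri.card_three B hB) hac (Ne.symm hwa) (Ne.symm hwc)
              hB1.1 hB1.2 hwB
          have hz : z = a ∨ z = c := by
            rw [hBe] at hzB
            simp only [mem_insert, mem_singleton] at hzB
            rcases hzB with h1 | h1 | h1
            · exact Or.inl h1
            · exact Or.inr h1
            · exact absurd h1 hzw
          refine hRA.trans (h.link_step hA hK sA sK hwa mA ?_ mK ?_)
          · rcases hz with rfl | rfl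
            · exact mem_cmap_of hac hac hzA
            · exact mem_cmap_c hac hzA
          · rcases hB2 with h1 | h1
            · exact mem_cmap_of hac hac h1
            · exact mem_cmap_c hac h1)
      hF hG hwF' hwG' (by
        intro K hK sK hwK hh
        rcases hh with rfl | hh
        · exact .refl
        · exact absurd hh.1 sF)
    exact this G hG sG hwG' (Or.inl rfl)

theorem ContrData.surv (h : ContrData T a c x y) {H : Finset V} (hH : H ∈ T) :
    ∃ L ∈ T, ¬ (a ∈ L ∧ c ∈ L) ∧ H.image (cmap a c) ⊆ L.image (cmap a c) := by
  have hac := h.hac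
  by_cases sH : a ∈ H ∧ c ∈ H
  · have gen : ∀ x y, ContrData T a c x y → ∃ L ∈ T, ¬ (a ∈ L ∧ c ∈ L) ∧
        ({a, c, x} : Finset V).image (cmap a c) ⊆ L.image (cmap a c) := by
      intro x y h
      obtain ⟨N, hN, haN, hxN, hcN, hun⟩ := h.nbr
      refine ⟨N, hN, by tauto, ?_⟩
      intro u hu
      rw [mem_cmap hac] at hu ⊢
      simp only [mem_insert, mem_singleton] at hu
      rcases hu with ⟨h1, rfl | rfl | rfl⟩ | ⟨rfl, -⟩
      · exact Or.inl ⟨h1, haN⟩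
      · exact absurd rfl h1
      · exact Or.inl ⟨h1, hxN⟩
      · exact Or.inl ⟨hac, haN⟩
    rcases h.dead hH sH.1 sH.2 with rfl | rfl
    · exact gen x y h
    · exact gen y x h.swap
  · exact ⟨H, hH, sH, Subset.rfl⟩

theorem ContrData.conn (h : ContrData T a c x y) (F' : Finset V)
    (hF' : F' ∈ contract T a c) (G' : Finset V) (hG' : G' ∈ contract T a c) :
    Relation.ReflTransGen (FaceAdj (contract T a c)) F' G' := by
  have hlink : ∀ F' ∈ contract T a c, ∀ G' ∈ contract T a c, ∀ w, w ∈ F' → w ∈ G' →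
      Relation.ReflTransGen (FaceAdj (contract T a c)) F' G' := by
    intro F' hF' G' hG' w h1 h2
    have hl := h.link_conn w F' hF' G' hG' h1 h2
    refine Relation.ReflTransGen.mono ?_ _ _ hl
    rintro A B ⟨h1, h2, h3, h4⟩
    exact ⟨h1, h2, h4⟩
  obtain ⟨F, hF, sF, rfl⟩ := h.mem_contract.1 hF'
  obtain ⟨G, hG, sG, rfl⟩ := h.mem_contract.1 hG'
  have := aux_all h.tri (fun H => ∀ K' ∈ contract T a c, ∀ w, w ∈ K' → w ∈ H.image (cmap a c) →
      Relation.ReflTransGen (FaceAdj (contract T a c)) (F.image (cmap a c)) K') (by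
    intro A hA B hB hAB hPA K' hK' w hwK hwB
    obtain ⟨L, hL, sL, hBL⟩ := h.surv hB
    have hLm := h.mem_contract.2 ⟨L, hL, sL, rfl⟩
    have : (A ∩ B).Nonempty := by rw [← card_pos]; omega
    obtain ⟨u, hu⟩ := this
    rw [mem_inter] at hu
    have e1 := hPA _ hLm (cmap a c u) (hBL (mem_image_of_mem _ hu.2)) (mem_image_of_mem _ hu.1)
    exact e1.trans (hlink _ hLm _ hK' w (hBL hwB) hwK)) hF hG
    (fun K' hK' w h1 h2 => hlink _ hF' _ hK' w h2 h1)
  have hne : (G.image (cmap a c)).Nonempty := by rw [← card_pos, h.card3 hG sG]; omega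
  obtain ⟨w, hw⟩ := hne
  exact this _ hG' w hw hw

theorem ContrData.isTri (h : ContrData T a c x y) : IsTriangulation (contract T a c) where
  nonempty := by
    obtain ⟨N, hN, haN, hxN, hcN, hun⟩ := h.nbr
    exact ⟨_, h.mem_contract.2 ⟨N, hN, by tauto, rfl⟩⟩
  card_three := by
    intro F' hF'
    obtain ⟨F, hF, sF, rfl⟩ := h.mem_contract.1 hF'
    exact h.card3 hF sF
  edge_two_faces := h.edge_two
  link_connected := fun w F hF G hG h1 h2 => h.link_conn w F hF G hG h1 h2
  connected := h.conn

end Contr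


section Euler
variable [DecidableEq V]

theorem two_mul_edges {T : Finset (Finset V)} (hT : IsTriangulation T) :
    2 * (edgeSet T).card = 3 * T.card := by
  have h := sum_card_bipartiteAbove_eq_sum_card_bipartiteBelow (s := edgeSet T) (t := T)
    (fun e F => e ⊆ F)
  have h1 : ∑ e ∈ edgeSet T, (bipartiteAbove (fun e F : Finset V => e ⊆ F) T e).card
      = (edgeSet T).card * 2 := by
    apply sum_const_nat
    intro e he
    simp only [edgeSet, mem_filter, mem_powersetCard] at he
    exact hT.edge_two_faces e he.1.2 he.2
  have h2 : ∑ F ∈ T, (bipartiteBelow (fun e F : Finset V => e ⊆ F) (edgeSet T) F).card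
      = T.card * 3 := by
    apply sum_const_nat
    intro F hF
    have : bipartiteBelow (fun e F : Finset V => e ⊆ F) (edgeSet T) F = F.powersetCard 2 := by
      ext e
      simp only [bipartiteBelow, edgeSet, mem_filter, mem_powersetCard]
      constructor
      · rintro ⟨⟨⟨_, h1⟩, _⟩, h2⟩; exact ⟨h2, h1⟩
      · rintro ⟨h1, h2⟩
        refine ⟨⟨⟨?_, h2⟩, F, hF, h1⟩, h1⟩
        intro t ht
        simp only [vertexSet, mem_biUnion, id]
        exact ⟨F, hF, h1 ht⟩
    rw [this, card_powersetCard, hT.card_three F hF]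
    rfl
  rw [h1, h2] at h
  omega

theorem two_mul_euler {T : Finset (Finset V)} (hT : IsTriangulation T) :
    2 * eulerChar T = 2 * ((vertexSet T).card : ℤ) - T.card := by
  have := two_mul_edges hT
  unfold eulerChar
  omega

/-- The tetrahedron is a sphere. -/
theorem euler_k4 {T : Finset (Finset V)} (hT : IsTriangulation T) {a c x y : V}
    (hac : a ≠ c) (hax : a ≠ x) (hay : a ≠ y) (hcx : c ≠ x) (hcy : c ≠ y) (hxy : x ≠ y)
    (h1 : {a, c, x} ∈ T) (h2 : {a, c, y} ∈ T) (h3 : {a, x, y} ∈ T) (h4 : {c, x, y} ∈ T) :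
    eulerChar T = 2 := by
  set Q : Finset V := {a, c, x, y} with hQ
  have hQc : Q.card = 4 := by
    rw [hQ, card_insert_of_notMem (by simp [*]), aux_card_three hcx hcy hxy]
  have her : ∀ t ∈ Q, Q.erase t ∈ T := by
    intro t ht
    simp only [hQ, mem_insert, mem_singleton] at ht
    rcases ht with rfl | rfl | rfl | rfl
    · convert h4 using 1; ext u; simp [hQ]; grind
    · convert h3 using 1; ext u; simp [hQ]; grind
    · convert h2 using 1; ext u; simp [hQ]; grind
    · convert h1 using 1; ext u; simp [hQ]; grind
  have hsub : ∀ F ⊆ Q, F.card = 3 → ∃ t ∈ Q, F = Q.erase t := by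
    intro F hF hc
    have : (Q \ F).card = 1 := by rw [card_sdiff_of_subset hF]; omega
    rw [card_eq_one] at this
    obtain ⟨t, ht⟩ := this
    have htm : t ∈ Q \ F := by rw [ht]; simp
    rw [mem_sdiff] at htm
    refine ⟨t, htm.1, ?_⟩
    apply eq_of_subset_of_card_le
    · intro u hu
      exact mem_erase.2 ⟨by rintro rfl; exact htm.2 hu, hF hu⟩
    · rw [card_erase_of_mem htm.1]; omega
  have hall : ∀ G ∈ T, G ⊆ Q := by
    intro G hG
    refine aux_all hT (fun F => F ⊆ Q) ?_ (her a (by simp [hQ])) hG (erase_subset _ _)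
    intro F hF G hG hFG hFQ
    obtain ⟨t, ht, rfl⟩ := hsub F hFQ (hT.card_three F hF)
    obtain ⟨u, z, huz, he⟩ := card_eq_two.1 hFG
    have hu : u ∈ Q.erase t ∩ G := by rw [he]; simp
    have hz : z ∈ Q.erase t ∩ G := by rw [he]; simp
    rw [mem_inter] at hu hz
    have : (((Q.erase t).erase u).erase z).card = 1 := by
      rw [card_erase_of_mem (mem_erase.2 ⟨huz.symm, hz.1⟩), card_erase_of_mem hu.1,
        card_erase_of_mem ht]; omega
    obtain ⟨s, hs⟩ := card_eq_one.1 this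
    have hsm : s ∈ ((Q.erase t).erase u).erase z := by rw [hs]; simp
    simp only [mem_erase] at hsm hu hz
    obtain ⟨H, hH, hHne, -, -, hun⟩ := aux_other hT huz hF (by simp [hu]) (by simp [hz])
    have e1 := hun _ (her s hsm.2.2.2) (by simp [hu]; tauto) (by simp [hz]; tauto)
    have e2 := hun G hG hu.2 hz.2
    have hne : Q.erase s ≠ Q.erase t := by
      intro hh
      have : t ∈ Q.erase s := mem_erase.2 ⟨fun h => hsm.2.2.1 h.symm, ht⟩
      rw [hh] at this
      simp at this
    rcases e1 with e1 | e1
    · exact absurd e1 hne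
    · rcases e2 with rfl | rfl
      · exact hFQ
      · rw [← e1]; exact erase_subset _ _
  have hTe : T = Q.powersetCard 3 := by
    ext F
    rw [mem_powersetCard]
    constructor
    · intro hF; exact ⟨hall F hF, hT.card_three F hF⟩
    · rintro ⟨hF, hc⟩
      obtain ⟨t, ht, rfl⟩ := hsub F hF hc
      exact her t ht
  have hTc : T.card = 4 := by rw [hTe, card_powersetCard, hQc]; rfl
  have hv : vertexSet T = Q := by
    ext u
    simp only [vertexSet, mem_biUnion, id]
    constructor
    · rintro ⟨F, hF, hu⟩; exact hall F hF hu
    · intro hu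
      simp only [hQ, mem_insert, mem_singleton] at hu
      rcases hu with rfl | rfl | rfl | rfl
      · exact ⟨_, h1, by simp⟩
      · exact ⟨_, h1, by simp⟩
      · exact ⟨_, h1, by simp⟩
      · exact ⟨_, h2, by simp⟩
  have := two_mul_euler hT
  rw [hv, hTc, hQc] at this
  push_cast at this
  omega

variable {T : Finset (Finset V)} {a c x y : V}

theorem ContrData.euler (h : ContrData T a c x y) : eulerChar (contract T a c) = eulerChar T := by
  have e1 := two_mul_euler h.tri
  have e2 := two_mul_euler h.isTri
  have hcard : (contract T a c).card + 2 = T.card := by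
    rw [contract_eq, card_image_of_injOn, ← card_filter_add_card_filter_not (s := T)
      (fun F => a ∈ F ∧ c ∈ F)]
    · have : (T.filter fun F => a ∈ F ∧ c ∈ F) = {{a, c, x}, {a, c, y}} := by
        ext F
        simp only [mem_filter, mem_insert, mem_singleton]
        constructor
        · rintro ⟨h1, h2, h3⟩; exact h.dead h1 h2 h3
        · rintro (rfl | rfl)
          · exact ⟨h.fx, by simp⟩
          · exact ⟨h.fy, by simp⟩
      rw [this, card_pair]
      · omega
      · intro he
        have hx : x ∈ ({a, c, y} : Finset V) := by rw [← he]; simp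
        simp [h.hax.symm, h.hcx.symm, h.hxy] at hx
    · intro F hF G hG hFG
      simp only [coe_filter, Set.mem_ofPred_eq] at hF hG
      exact h.inj hF.1 hG.1 hF.2 hG.2 hFG
  have hv : vertexSet (contract T a c) = (vertexSet T).erase c := by
    ext u
    simp only [vertexSet, mem_biUnion, id, mem_erase]
    constructor
    · rintro ⟨F', hF', hu⟩
      obtain ⟨F, hF, sF, rfl⟩ := h.mem_contract.1 hF'
      rw [mem_cmap h.hac] at hu
      rcases hu with ⟨h1, h2⟩ | ⟨rfl, h2⟩
      · exact ⟨h1, F, hF, h2⟩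
      · exact ⟨h.hac, _, h.fx, by simp⟩
    · rintro ⟨huc, F, hF, hu⟩
      obtain ⟨L, hL, sL, hs⟩ := h.surv hF
      exact ⟨_, h.mem_contract.2 ⟨L, hL, sL, rfl⟩, hs (mem_cmap_of h.hac huc hu)⟩
  have hcv : c ∈ vertexSet T := by
    simp only [vertexSet, mem_biUnion, id]
    exact ⟨_, h.fx, by simp⟩
  have hvc : (vertexSet (contract T a c)).card + 1 = (vertexSet T).card := by
    rw [hv, card_erase_add_one hcv]
  omega

end Euler

section Orient
variable [DecidableEq V]

theorem cyc_mk {u v w : V} (h1 : u ≠ v) (h2 : u ≠ w) (h3 : v ≠ w) :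
    IsCyclicOrientation {u, v, w} {(u, v), (v, w), (w, u)} := by
  refine ⟨?_, ?_, ?_⟩
  · rw [card_eq_three]
    exact ⟨_, _, _, by simp [h1], by simp [h2], by simp [h3], rfl⟩
  · intro p hp
    simp only [mem_insert, mem_singleton] at hp
    rcases hp with rfl | rfl | rfl <;> simp [*, Ne.symm h2]
  · intro t ht
    simp only [mem_insert, mem_singleton] at ht
    simp only [card_eq_one]
    rcases ht with rfl | rfl | rfl
    · refine ⟨⟨(t, v), ?_⟩, ⟨(w, t), ?_⟩⟩ <;> (ext ⟨p, q⟩; simp; grind)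
    · refine ⟨⟨(t, w), ?_⟩, ⟨(u, t), ?_⟩⟩ <;> (ext ⟨p, q⟩; simp; grind)
    · refine ⟨⟨(t, u), ?_⟩, ⟨(v, t), ?_⟩⟩ <;> (ext ⟨p, q⟩; simp; grind)

theorem cyc_exists {F : Finset V} {d : Finset (V × V)} (hF : F.card = 3)
    (h : IsCyclicOrientation F d) : ∃ u v w, u ≠ v ∧ u ≠ w ∧ v ≠ w ∧ F = {u, v, w} ∧
      d = {(u, v), (v, w), (w, u)} := by
  obtain ⟨hc, hm, hdeg⟩ := h
  obtain ⟨u, v, w, huv, huw, hvw, rfl⟩ := card_eq_three.1 hF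
  have hout : ∀ s ∈ ({u, v, w} : Finset V), ∃ t, (s, t) ∈ d ∧ ∀ t', (s, t') ∈ d → t' = t := by
    intro s hs
    obtain ⟨⟨p, q⟩, hp⟩ := card_eq_one.1 (hdeg s hs).1
    have hpm : (p, q) ∈ d.filter fun p => p.1 = s := by rw [hp]; simp
    simp only [mem_filter] at hpm
    obtain ⟨h1, rfl⟩ := hpm
    refine ⟨q, h1, fun t' ht' => ?_⟩
    have : (p, t') ∈ d.filter fun r => r.1 = p := by simp [ht']
    rw [hp] at this
    simpa using this
  have hin : ∀ s ∈ ({u, v, w} : Finset V), ∀ t t', (t, s) ∈ d → (t', s) ∈ d → t = t' := by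
    intro s hs t t' h1 h2
    obtain ⟨p, hp⟩ := card_eq_one.1 (hdeg s hs).2
    have m1 : (t, s) ∈ d.filter fun r => r.2 = s := by simp [h1]
    have m2 : (t', s) ∈ d.filter fun r => r.2 = s := by simp [h2]
    rw [hp] at m1 m2
    simp only [mem_singleton] at m1 m2
    have := m1.trans m2.symm
    simpa using this
  have hmem : ∀ s t, (s, t) ∈ d → (t = u ∨ t = v ∨ t = w) ∧ s ≠ t := by
    intro s t hst
    have := hm _ hst
    simp only [mem_insert, mem_singleton] at this
    exact ⟨this.2.1, this.2.2⟩
  have fin : ∀ u v w : V, u ≠ v → u ≠ w → v ≠ w → (u, v) ∈ d → (v, w) ∈ d → (w, u) ∈ d →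
      d = {(u, v), (v, w), (w, u)} := by
    intro u v w huv huw hvw h1 h2 h3
    symm
    apply eq_of_subset_of_card_le
    · intro t ht
      simp only [mem_insert, mem_singleton] at ht
      rcases ht with rfl | rfl | rfl <;> assumption
    · rw [hc, (cyc_mk huv huw hvw).1]
  obtain ⟨tu, hu1, -⟩ := hout u (by simp)
  obtain ⟨tv, hv1, -⟩ := hout v (by simp)
  obtain ⟨tw, hw1, -⟩ := hout w (by simp)
  have mu := hmem _ _ hu1
  have mv := hmem _ _ hv1
  have mw := hmem _ _ hw1
  have iu := hin u (by simp)
  have iv := hin v (by simp)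
  have iw := hin w (by simp)
  have hcase : (tu = v ∧ tv = w ∧ tw = u) ∨ (tu = w ∧ tw = v ∧ tv = u) := by
    grind
  rcases hcase with ⟨rfl, rfl, rfl⟩ | ⟨rfl, rfl, rfl⟩
  · exact ⟨_, _, _, huv, huw, hvw, rfl, fin _ _ _ huv huw hvw hu1 hv1 hw1⟩
  · refine ⟨_, _, _, huw, huv, hvw.symm, ?_, fin _ _ _ huw huv hvw.symm hu1 hw1 hv1⟩
    rw [pair_comm]

theorem cyc_anti {F : Finset V} {d : Finset (V × V)} (hF : F.card = 3)
    (h : IsCyclicOrientation F d) {s t : V} (hst : (s, t) ∈ d) : (t, s) ∉ d := by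
  obtain ⟨u, v, w, h1, h2, h3, rfl, rfl⟩ := cyc_exists hF h
  simp at hst ⊢; grind

theorem cyc_tot {F : Finset V} {d : Finset (V × V)} (hF : F.card = 3)
    (h : IsCyclicOrientation F d) {s t : V} (hs : s ∈ F) (ht : t ∈ F) (hne : s ≠ t) :
    (s, t) ∈ d ∨ (t, s) ∈ d := by
  obtain ⟨u, v, w, h1, h2, h3, rfl, rfl⟩ := cyc_exists hF h
  simp at hs ht ⊢; grind

theorem cyc_out {F : Finset V} {d : Finset (V × V)} (hF : F.card = 3)
    (h : IsCyclicOrientation F d) {s t t' : V} (h1 : (s, t) ∈ d) (h2 : (s, t') ∈ d) : t = t' := by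
  obtain ⟨u, v, w, h3, h4, h5, rfl, rfl⟩ := cyc_exists hF h
  simp at h1 h2; grind

theorem cyc_in {F : Finset V} {d : Finset (V × V)} (hF : F.card = 3)
    (h : IsCyclicOrientation F d) {s t t' : V} (h1 : (t, s) ∈ d) (h2 : (t', s) ∈ d) : t = t' := by
  obtain ⟨u, v, w, h3, h4, h5, rfl, rfl⟩ := cyc_exists hF h
  simp at h1 h2; grind

theorem cyc_push {F : Finset V} {d : Finset (V × V)} (hF : F.card = 3)
    (h : IsCyclicOrientation F d) {f : V → V} (hf : Set.InjOn f F) :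
    IsCyclicOrientation (F.image f) (d.image (Prod.map f f)) := by
  obtain ⟨u, v, w, h3, h4, h5, rfl, rfl⟩ := cyc_exists hF h
  simp only [image_insert, image_singleton, Prod.map_apply]
  apply cyc_mk
  · exact fun hh => h3 (hf (by simp) (by simp) hh)
  · exact fun hh => h4 (hf (by simp) (by simp) hh)
  · exact fun hh => h5 (hf (by simp) (by simp) hh)

theorem cyc_lift {F : Finset V} {d : Finset (V × V)} (hF : F.card = 3) {f : V → V}
    (hf : Set.InjOn f F) (h : IsCyclicOrientation (F.image f) d) :
    IsCyclicOrientation F ((F ×ˢ F).filter fun p => (f p.1, f p.2) ∈ d) := by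
  have hc : (F.image f).card = 3 := by rw [card_image_of_injOn hf, hF]
  obtain ⟨u', v', w', h3, h4, h5, he, rfl⟩ := cyc_exists hc h
  have mu : u' ∈ F.image f := by rw [he]; simp
  have mv : v' ∈ F.image f := by rw [he]; simp
  have mw : w' ∈ F.image f := by rw [he]; simp
  rw [mem_image] at mu mv mw
  obtain ⟨u, hu, rfl⟩ := mu
  obtain ⟨v, hv, rfl⟩ := mv
  obtain ⟨w, hw, rfl⟩ := mw
  have n1 : u ≠ v := fun hh => h3 (by rw [hh])
  have n2 : u ≠ w := fun hh => h4 (by rw [hh])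
  have n3 : v ≠ w := fun hh => h5 (by rw [hh])
  have hFe := aux_eq_of_three hF n1 n2 n3 hu hv hw
  have hd : ((F ×ˢ F).filter fun p => (f p.1, f p.2) ∈
      ({(f u, f v), (f v, f w), (f w, f u)} : Finset (V × V))) = {(u, v), (v, w), (w, u)} := by
    ext ⟨p, q⟩
    simp only [mem_filter, mem_product, mem_insert, mem_singleton, Prod.mk.injEq]
    constructor
    · rintro ⟨⟨hp, hq⟩, ⟨e1, e2⟩ | ⟨e1, e2⟩ | ⟨e1, e2⟩⟩
      · exact Or.inl ⟨hf hp hu e1, hf hq hv e2⟩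
      · exact Or.inr (Or.inl ⟨hf hp hv e1, hf hq hw e2⟩)
      · exact Or.inr (Or.inr ⟨hf hp hw e1, hf hq hu e2⟩)
    · rintro (⟨rfl, rfl⟩ | ⟨rfl, rfl⟩ | ⟨rfl, rfl⟩) <;> simp [*]
  rw [hd, hFe]
  exact cyc_mk n1 n2 n3

variable {T : Finset (Finset V)} {a c x y : V}

theorem ContrData.orient_push (h : ContrData T a c x y) (ho : Orientable T) :
    Orientable (contract T a c) := by
  obtain ⟨o, ho1, ho2⟩ := ho
  let o' : Finset V → Finset (V × V) := fun F' =>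
    if hh : ∃ F, F ∈ T ∧ ¬ (a ∈ F ∧ c ∈ F) ∧ F.image (cmap a c) = F' then
      (o hh.choose).image (Prod.map (cmap a c) (cmap a c)) else ∅
  have ho' : ∀ F ∈ T, ¬ (a ∈ F ∧ c ∈ F) → o' (F.image (cmap a c)) =
      (o F).image (Prod.map (cmap a c) (cmap a c)) := by
    intro F hF sF
    have hh : ∃ G, G ∈ T ∧ ¬ (a ∈ G ∧ c ∈ G) ∧ G.image (cmap a c) = F.image (cmap a c) :=
      ⟨F, hF, sF, rfl⟩
    have : hh.choose = F :=
      h.inj hh.choose_spec.1 hF hh.choose_spec.2.1 sF hh.choose_spec.2.2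
    simp only [o']
    rw [dif_pos hh, this]
  -- the key conflict
  have k1 : ∀ a c x y, ContrData T a c x y → ∀ F ∈ T, ∀ G ∈ T, c ∉ F → a ∉ G →
      (a, x) ∈ o F → (c, x) ∈ o G → False := by
    intro a c x y h F hF G hG hcF haG h1 h2
    have hD := ho1 _ h.fx
    have hDc := h.tri.card_three _ h.fx
    have n1 : F ≠ {a, c, x} := by rintro rfl; simp at hcF
    have n2 : G ≠ {a, c, x} := by rintro rfl; simp at haG
    have m1 := (cyc_tot hDc hD (s := a) (t := x) (by simp) (by simp) h.hax).resolve_left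
      (ho2 F hF _ h.fx n1 _ h1)
    have m2 := (cyc_tot hDc hD (s := c) (t := x) (by simp) (by simp) h.hcx).resolve_left
      (ho2 G hG _ h.fx n2 _ h2)
    exact h.hac (cyc_out hDc hD m1 m2)
  have k2 : ∀ a c x y, ContrData T a c x y → ∀ F ∈ T, ∀ G ∈ T, c ∉ F → a ∉ G →
      (x, a) ∈ o F → (x, c) ∈ o G → False := by
    intro a c x y h F hF G hG hcF haG h1 h2
    have hD := ho1 _ h.fx
    have hDc := h.tri.card_three _ h.fx
    have n1 : F ≠ {a, c, x} := by rintro rfl; simp at hcF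
    have n2 : G ≠ {a, c, x} := by rintro rfl; simp at haG
    have m1 := (cyc_tot hDc hD (s := a) (t := x) (by simp) (by simp) h.hax).resolve_right
      (ho2 F hF _ h.fx n1 _ h1)
    have m2 := (cyc_tot hDc hD (s := c) (t := x) (by simp) (by simp) h.hcx).resolve_right
      (ho2 G hG _ h.fx n2 _ h2)
    exact h.hac (cyc_in hDc hD m1 m2)
  have k3 : ∀ a c, ContrData T a c x y → ∀ z, ∀ F ∈ T, ∀ G ∈ T, c ∉ F → a ∉ G →
      (a, z) ∈ o F → (c, z) ∈ o G → False := by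
    intro a c h z F hF G hG hcF haG h1 h2
    have e1 := (ho1 F hF).2.1 _ h1
    have e2 := (ho1 G hG).2.1 _ h2
    simp only at e1 e2
    rcases h.common z F hF G hG e1.1 e1.2.1 e2.1 e2.2.1 e1.2.2.symm e2.2.2.symm with rfl | rfl
    · exact k1 _ _ _ _ h F hF G hG hcF haG h1 h2
    · exact k1 _ _ _ _ h.swap F hF G hG hcF haG h1 h2
  have k4 : ∀ a c, ContrData T a c x y → ∀ z, ∀ F ∈ T, ∀ G ∈ T, c ∉ F → a ∉ G →
      (z, a) ∈ o F → (z, c) ∈ o G → False := by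
    intro a c h z F hF G hG hcF haG h1 h2
    have e1 := (ho1 F hF).2.1 _ h1
    have e2 := (ho1 G hG).2.1 _ h2
    simp only at e1 e2
    rcases h.common z F hF G hG e1.2.1 e1.1 e2.2.1 e2.1 e1.2.2 e2.2.2 with rfl | rfl
    · exact k2 _ _ _ _ h F hF G hG hcF haG h1 h2
    · exact k2 _ _ _ _ h.swap F hF G hG hcF haG h1 h2
  have hfib : ∀ s s', cmap a c s = cmap a c s' → s = s' ∨ (s = a ∧ s' = c) ∨ (s = c ∧ s' = a) := by
    intro s s' hh
    simp only [cmap] at hh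
    split_ifs at hh <;> grind
  refine ⟨o', ?_, ?_⟩
  · intro F' hF'
    obtain ⟨F, hF, sF, rfl⟩ := h.mem_contract.1 hF'
    rw [ho' F hF sF]
    exact cyc_push (h.tri.card_three F hF) (ho1 F hF) (cmap_injOn sF)
  · intro F' hF' G' hG' hne p hpF hpG
    obtain ⟨F, hF, sF, rfl⟩ := h.mem_contract.1 hF'
    obtain ⟨G, hG, sG, rfl⟩ := h.mem_contract.1 hG'
    have hFG : F ≠ G := fun hh => hne (by rw [hh])
    rw [ho' F hF sF, mem_image] at hpF
    rw [ho' G hG sG, mem_image] at hpG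
    obtain ⟨⟨s, t⟩, hst, rfl⟩ := hpF
    obtain ⟨⟨s', t'⟩, hst', he⟩ := hpG
    simp only [Prod.map_apply, Prod.mk.injEq] at he
    have e1 := (ho1 F hF).2.1 _ hst
    have e2 := (ho1 G hG).2.1 _ hst'
    simp only at e1 e2
    have hFc : ∀ {u}, u ∈ F → u = a → c ∉ F := by rintro u h1 rfl h2; exact sF ⟨h1, h2⟩
    have hFa : ∀ {u}, u ∈ F → u = c → a ∉ F := by rintro u h1 rfl h2; exact sF ⟨h2, h1⟩
    have hGc : ∀ {u}, u ∈ G → u = a → c ∉ G := by rintro u h1 rfl h2; exact sG ⟨h1, h2⟩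
    have hGa : ∀ {u}, u ∈ G → u = c → a ∉ G := by rintro u h1 rfl h2; exact sG ⟨h2, h1⟩
    rcases hfib _ _ he.1 with h1 | ⟨h1, h1'⟩ | ⟨h1, h1'⟩ <;>
      rcases hfib _ _ he.2 with h2 | ⟨h2, h2'⟩ | ⟨h2, h2'⟩
    · rw [h1, h2] at hst'
      exact ho2 F hF G hG hFG _ hst hst'
    · rw [h1, h2] at hst'; rw [h2'] at hst
      exact k4 a c h s G hG F hF (hGc e2.2.1 h2) (hFa e1.2.1 h2') hst' hst
    · rw [h1, h2] at hst'; rw [h2'] at hst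
      exact k4 a c h s F hF G hG (hFc e1.2.1 h2') (hGa e2.2.1 h2) hst hst'
    · rw [h1, h2] at hst'; rw [h1'] at hst
      exact k3 a c h t G hG F hF (hGc e2.1 h1) (hFa e1.1 h1') hst' hst
    · exact e2.2.2 (h1.trans h2.symm)
    · exact sG ⟨h1 ▸ e2.1, h2 ▸ e2.2.1⟩
    · rw [h1, h2] at hst'; rw [h1'] at hst
      exact k3 a c h t F hF G hG (hFc e1.1 h1') (hGa e2.1 h1) hst hst'
    · exact sG ⟨h2 ▸ e2.2.1, h1 ▸ e2.1⟩
    · exact e2.2.2 (h1.trans h2.symm)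

/-- Orientations of the surviving faces at `a` are transported along the arc. -/
theorem ContrData.orient_arc (h : ContrData T a c x y) (o : Finset V → Finset (V × V))
    (ho1 : ∀ F ∈ T, a ∈ F → c ∉ F → IsCyclicOrientation F (o F))
    (ho2 : ∀ F ∈ T, ∀ G ∈ T, a ∈ F → a ∈ G → c ∉ F → c ∉ G → F ≠ G → ∀ p ∈ o F, p ∉ o G)
    {N M : Finset V} (hN : N ∈ T) (haN : a ∈ N) (hxN : x ∈ N) (hcN : c ∉ N)
    (hM : M ∈ T) (haM : a ∈ M) (hyM : y ∈ M) (hcM : c ∉ M) :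
    (a, x) ∈ o N ↔ (a, y) ∉ o M := by
  let S := T.filter fun F => a ∈ F ∧ c ∉ F
  let s : Finset V → V → ℤ := fun F z => if (a, z) ∈ o F then 1 else -1
  have hS : ∀ F, F ∈ S ↔ F ∈ T ∧ a ∈ F ∧ c ∉ F := by intro F; simp [S]
  have h0 : ∑ F ∈ S, ∑ z ∈ F.erase a, s F z = 0 := by
    apply sum_eq_zero
    intro F hF
    rw [hS] at hF
    have hFc := h.tri.card_three F hF.1
    obtain ⟨u, v, w, n1, n2, n3, rfl, hd⟩ := cyc_exists hFc (ho1 F hF.1 hF.2.1 hF.2.2)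
    simp only [s, hd]
    have ha := hF.2.1
    simp only [mem_insert, mem_singleton] at ha
    rcases ha with ha | ha | ha
    · have : ({u, v, w} : Finset V).erase a = {v, w} := by ext t; simp; grind
      rw [this, sum_pair n3, if_pos (by simp [ha]), if_neg (by simp [ha]; grind)]; rfl
    · have : ({u, v, w} : Finset V).erase a = {u, w} := by ext t; simp; grind
      rw [this, sum_pair n2, if_neg (by simp [ha]; grind), if_pos (by simp [ha])]; rfl
    · have : ({u, v, w} : Finset V).erase a = {u, v} := by ext t; simp; grind
      rw [this, sum_pair n1, if_pos (by simp [ha]), if_neg (by simp [ha]; grind)]; rfl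
  rw [sum_comm' (t' := (vertexSet T).erase a) (s' := fun z => S.filter fun F => z ∈ F)] at h0
  swap
  · intro F z
    simp only [hS, mem_erase, mem_filter, vertexSet, mem_biUnion, id]
    constructor
    · rintro ⟨⟨h1, h2, h3⟩, h4, h5⟩; exact ⟨⟨⟨h1, h2, h3⟩, h5⟩, h4, F, h1, h5⟩
    · rintro ⟨⟨⟨h1, h2, h3⟩, h5⟩, h4, _⟩; exact ⟨⟨h1, h2, h3⟩, h4, h5⟩
  have hxv : x ∈ (vertexSet T).erase a := by
    simp only [mem_erase, vertexSet, mem_biUnion, id]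
    exact ⟨h.hax.symm, N, hN, hxN⟩
  have hyv : y ∈ (vertexSet T).erase a := by
    simp only [mem_erase, vertexSet, mem_biUnion, id]
    exact ⟨h.hay.symm, M, hM, hyM⟩
  rw [sum_eq_add x y h.hxy ?_ (fun hh => absurd hxv hh) (fun hh => absurd hyv hh)] at h0
  · have ex : (S.filter fun F => x ∈ F) = {N} := by
      obtain ⟨N0, _, _, _, _, hun⟩ := h.nbr
      ext K
      simp only [mem_filter, hS, mem_singleton]
      constructor
      · rintro ⟨⟨h1, h2, h3⟩, h4⟩
        rw [hun K h1 h2 h4 h3, hun N hN haN hxN hcN]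
      · rintro rfl; exact ⟨⟨hN, haN, hcN⟩, hxN⟩
    have ey : (S.filter fun F => y ∈ F) = {M} := by
      obtain ⟨N0, _, _, _, _, hun⟩ := h.swap.nbr
      ext K
      simp only [mem_filter, hS, mem_singleton]
      constructor
      · rintro ⟨⟨h1, h2, h3⟩, h4⟩
        rw [hun K h1 h2 h4 h3, hun M hM haM hyM hcM]
      · rintro rfl; exact ⟨⟨hM, haM, hcM⟩, hyM⟩
    rw [ex, ey, sum_singleton, sum_singleton] at h0
    simp only [s] at h0
    split_ifs at h0 with h1 h2 h2 <;> simp_all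
  · rintro z hz ⟨hzx, hzy⟩
    rw [mem_erase] at hz
    by_cases hex : ∃ F ∈ S, z ∈ F
    · obtain ⟨F, hF, hzF⟩ := hex
      rw [hS] at hF
      obtain ⟨hFT, haF, hcF⟩ := hF
      obtain ⟨G, hG, hGF, haG, hzG, hun⟩ := aux_other h.tri hz.1.symm hFT haF hzF
      have hcG : c ∉ G := by
        intro hcG
        have hzc : z ≠ c := by rintro rfl; exact hcF hzF
        have := h.common z F hFT G hG haF hzF hcG hzG hz.1 hzc
        tauto
      have : (S.filter fun F => z ∈ F) = {F, G} := by
        ext K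
        simp only [mem_filter, hS, mem_insert, mem_singleton]
        constructor
        · rintro ⟨⟨h1, h2, h3⟩, h4⟩; exact hun K h1 h2 h4
        · rintro (rfl | rfl)
          · exact ⟨⟨hFT, haF, hcF⟩, hzF⟩
          · exact ⟨⟨hG, haG, hcG⟩, hzG⟩
      rw [this, sum_pair hGF.symm]
      have d1 := ho2 F hFT G hG haF haG hcF hcG hGF.symm (a, z)
      have d2 := ho2 F hFT G hG haF haG hcF hcG hGF.symm (z, a)
      have t1 := cyc_tot (h.tri.card_three F hFT) (ho1 F hFT haF hcF) haF hzF hz.1.symm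
      have t2 := cyc_tot (h.tri.card_three G hG) (ho1 G hG haG hcG) haG hzG hz.1.symm
      simp only [s]
      split_ifs with h1 h2 h2
      · exact absurd h2 (d1 h1)
      · rfl
      · rfl
      · exact absurd (t2.resolve_left h2) (d2 (t1.resolve_left h1))
    · apply sum_eq_zero
      intro F hF
      rw [mem_filter] at hF
      exact absurd ⟨F, hF.1, hF.2⟩ hex

/-- Orientation of a dead face. -/
def deadOr (a c x : V) (b : Prop) [Decidable b] : Finset (V × V) :=
  if b then {(a, x), (x, c), (c, a)} else {(x, a), (a, c), (c, x)}

theorem deadOr_cyc (h : ContrData T a c x y) (b : Prop) [Decidable b] :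
    IsCyclicOrientation {a, c, x} (deadOr a c x b) := by
  unfold deadOr
  split_ifs
  · have := cyc_mk h.hax h.hac h.hcx.symm
    rwa [pair_comm x c] at this
  · have := cyc_mk h.hax.symm h.hcx.symm h.hac
    have e : ({x, a, c} : Finset V) = {a, c, x} := by ext t; simp; tauto
    rwa [e] at this

theorem deadOr_disj (h : ContrData T a c x y) (b b' : Prop) [Decidable b] [Decidable b']
    (hb : b ↔ ¬ b') (p : V × V) (hp : p ∈ deadOr a c x b) (hp' : p ∈ deadOr a c y b') : False := by
  have h1 := h.hac; have h2 := h.hax; have h3 := h.hay; have h4 := h.hcx; have h5 := h.hcy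
  have h6 := h.hxy
  obtain ⟨p1, p2⟩ := p
  unfold deadOr at hp hp'
  split_ifs at hp hp' <;> simp at hp hp' <;> grind

theorem ContrData.orient_lift (h : ContrData T a c x y) (ho : Orientable (contract T a c)) :
    Orientable T := by
  obtain ⟨o', ho1, ho2⟩ := ho
  have hac := h.hac
  let f := cmap a c
  have fa : f a = a := by simp [f, cmap]
  have fc : f c = a := by simp [f, cmap]
  have fo : ∀ z, z ≠ c → f z = z := by intro z hz; simp [f, cmap, hz]
  let o0 : Finset V → Finset (V × V) := fun F =>
    (F ×ˢ F).filter fun p => (f p.1, f p.2) ∈ o' (F.image f)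
  have hc0 : ∀ F ∈ T, ¬ (a ∈ F ∧ c ∈ F) → IsCyclicOrientation F (o0 F) := by
    intro F hF sF
    exact cyc_lift (h.tri.card_three F hF) (cmap_injOn sF)
      (ho1 _ (h.mem_contract.2 ⟨F, hF, sF, rfl⟩))
  have hd0 : ∀ F ∈ T, ∀ G ∈ T, ¬ (a ∈ F ∧ c ∈ F) → ¬ (a ∈ G ∧ c ∈ G) → F ≠ G →
      ∀ p, p ∈ o' (F.image f) → p ∈ o' (G.image f) → False := by
    intro F hF G hG sF sG hne p hp hq
    exact ho2 _ (h.mem_contract.2 ⟨F, hF, sF, rfl⟩) _ (h.mem_contract.2 ⟨G, hG, sG, rfl⟩)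
      (fun hh => hne (h.inj hF hG sF sG hh)) p hp hq
  have hm0 : ∀ F p, p ∈ o0 F → (p.1 ∈ F ∧ p.2 ∈ F) ∧ (f p.1, f p.2) ∈ o' (F.image f) := by
    intro F p hp
    simp only [o0, mem_filter, mem_product] at hp
    exact hp
  obtain ⟨N, hN, haN, hxN, hcN, hun⟩ := h.nbr
  obtain ⟨M, hM, haM, hyM, hcM, hunM⟩ := h.swap.nbr
  have hbb : (a, x) ∈ o0 N ↔ (a, y) ∉ o0 M := by
    refine h.orient_arc o0 (fun F hF _ h2 => hc0 F hF (fun hh => h2 hh.2)) ?_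
      hN haN hxN hcN hM haM hyM hcM
    intro F hF G hG _ _ h3 h4 hne p hp hq
    exact hd0 F hF G hG (fun hh => h3 hh.2) (fun hh => h4 hh.2) hne _ (hm0 _ _ hp).2 (hm0 _ _ hq).2
  -- a dead face does not conflict with a surviving one
  have hdead : ∀ x y, ContrData T a c x y → ∀ N ∈ T, a ∈ N → x ∈ N → c ∉ N →
      (∀ K ∈ T, a ∈ K → x ∈ K → c ∉ K → K = N) → ∀ G ∈ T, ¬ (a ∈ G ∧ c ∈ G) →
      ∀ p, p ∈ deadOr a c x ((a, x) ∉ o0 N) → p ∈ o0 G → False := by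
    intro x y h N hN haN hxN hcN hun G hG sG p hp hpG
    have sN : ¬ (a ∈ N ∧ c ∈ N) := fun hh => hcN hh.2
    obtain ⟨⟨m1, m2⟩, m3⟩ := hm0 _ _ hpG
    have fx : f x = x := fo x h.hcx.symm
    have tot := cyc_tot (h.tri.card_three N hN) (hc0 N hN sN) haN hxN h.hax
    unfold deadOr at hp
    split_ifs at hp with hb
    · have hax := hb
      simp only [mem_insert, mem_singleton] at hp
      rcases hp with rfl | rfl | rfl
      · have := hun G hG m2 m1 (fun hh => sG ⟨m2, hh⟩)
        subst this
        exact cyc_anti (h.tri.card_three G hG) (hc0 G hG sG) hax hpG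
      · exact sG ⟨m1, m2⟩
      · have hne : N ≠ G := by rintro rfl; exact hcN m1
        have e := (hm0 _ _ hax).2
        simp only [fa, fx, fc] at e m3
        exact hd0 N hN G hG sN sG hne _ e m3
    · have hxa := tot.resolve_left hb
      simp only [mem_insert, mem_singleton] at hp
      rcases hp with rfl | rfl | rfl
      · have := hun G hG m1 m2 (fun hh => sG ⟨m1, hh⟩)
        subst this
        exact hb hpG
      · have hne : N ≠ G := by rintro rfl; exact hcN m2
        have e := (hm0 _ _ hxa).2
        simp only [fa, fx, fc] at e m3
        exact hd0 N hN G hG sN sG hne _ e m3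
      · exact sG ⟨m2, m1⟩
  let o : Finset V → Finset (V × V) := fun F =>
    if a ∈ F ∧ c ∈ F then
      (if x ∈ F then deadOr a c x ((a, x) ∉ o0 N) else deadOr a c y ((a, y) ∉ o0 M))
    else o0 F
  have oS : ∀ F, ¬ (a ∈ F ∧ c ∈ F) → o F = o0 F := by intro F sF; simp only [o, if_neg sF]
  have oX : o {a, c, x} = deadOr a c x ((a, x) ∉ o0 N) := by simp [o]
  have hxn : x ∉ ({a, c, y} : Finset V) := by simp [h.hax.symm, h.hcx.symm, h.hxy]
  have oY : o {a, c, y} = deadOr a c y ((a, y) ∉ o0 M) := by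
    simp only [o, if_neg hxn]; simp
  have hdx := hdead x y h N hN haN hxN hcN hun
  have hdy := hdead y x h.swap M hM haM hyM hcM hunM
  have hdxy := deadOr_disj h ((a, x) ∉ o0 N) ((a, y) ∉ o0 M) (by rw [hbb])
  refine ⟨o, ?_, ?_⟩
  · intro F hF
    by_cases sF : a ∈ F ∧ c ∈ F
    · rcases h.dead hF sF.1 sF.2 with rfl | rfl
      · rw [oX]; exact deadOr_cyc h _
      · rw [oY]; exact deadOr_cyc h.swap _
    · rw [oS F sF]; exact hc0 F hF sF
  · intro F hF G hG hne p hpF hpG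
    by_cases sF : a ∈ F ∧ c ∈ F <;> by_cases sG : a ∈ G ∧ c ∈ G
    · rcases h.dead hF sF.1 sF.2 with rfl | rfl <;> rcases h.dead hG sG.1 sG.2 with rfl | rfl
      · exact hne rfl
      · rw [oX] at hpF; rw [oY] at hpG; exact hdxy p hpF hpG
      · rw [oX] at hpG; rw [oY] at hpF; exact hdxy p hpG hpF
      · exact hne rfl
    · rw [oS G sG] at hpG
      rcases h.dead hF sF.1 sF.2 with rfl | rfl
      · rw [oX] at hpF; exact hdx G hG sG p hpF hpG
      · rw [oY] at hpF; exact hdy G hG sG p hpF hpG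
    · rw [oS F sF] at hpF
      rcases h.dead hG sG.1 sG.2 with rfl | rfl
      · rw [oX] at hpG; exact hdx F hF sF p hpG hpF
      · rw [oY] at hpG; exact hdy F hF sF p hpG hpF
    · rw [oS F sF] at hpF; rw [oS G sG] at hpG
      exact hd0 F hF G hG sF sG hne _ (hm0 _ _ hpF).2 (hm0 _ _ hpG).2

theorem nonfacial_of_irreducible (h : IrreducibleTri T) (hs : eulerChar T ≠ 2) (a u : V)
    (hau : Adj T a u) : ∃ z, z ≠ a ∧ z ≠ u ∧ Adj T a z ∧ Adj T u z ∧ {a, u, z} ∉ T := by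
  obtain ⟨hT, hirr⟩ := h
  obtain ⟨hne, F, hF, hsub⟩ := hau
  have haF : a ∈ F := hsub (by simp)
  have huF : u ∈ F := hsub (by simp)
  by_contra hcon
  push Not at hcon
  obtain ⟨G, hG, hGF, haG, huG, hun⟩ := aux_other hT hne hF haF huF
  obtain ⟨x, hxa, hxu, rfl⟩ := aux_third (hT.card_three F hF) hne haF huF
  obtain ⟨y, hya, hyu, rfl⟩ := aux_third (hT.card_three G hG) hne haG huG
  have hxy : x ≠ y := by rintro rfl; exact hGF rfl
  have hd : ContrData T a u x y :=
    { tri := hT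
      hac := hne
      hax := hxa.symm
      hay := hya.symm
      hcx := hxu.symm
      hcy := hyu.symm
      hxy := hxy
      fx := hF
      fy := hG
      common := by
        intro z A hA B hB haA hzA huB hzB hza hzu
        have hf := hcon z hza hzu ⟨hza.symm, A, hA, by simp [insert_subset_iff, *]⟩
          ⟨hzu.symm, B, hB, by simp [insert_subset_iff, *]⟩
        have := hun _ hf (by simp) (by simp)
        have hz : z ∈ ({a, u, z} : Finset V) := by simp
        rcases this with e | e <;> rw [e] at hz <;> simp [hza, hzu] at hz
        · exact Or.inl hz
        · exact Or.inr hz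
      nk4 := by
        rintro ⟨h1, h2⟩
        exact hs (euler_k4 hT hne hxa.symm hya.symm hxu.symm hyu.symm hxy hF hG h1 h2) }
  have hedge : ({a, u} : Finset V) ∈ edgeSet T := by
    simp only [edgeSet, mem_filter, mem_powersetCard]
    refine ⟨⟨?_, card_pair hne⟩, _, hF, hsub⟩
    intro t ht
    simp only [vertexSet, mem_biUnion, id]
    exact ⟨_, hF, hsub ht⟩
  exact hirr _ hedge ⟨a, u, rfl, hedge, hd.isTri, hd.euler, hd.orient_lift, hd.orient_push⟩

end Orient

/-- Theorem 1 of the paper: in an irreducible triangulation of a surface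
other than the sphere, every vertex `v` lies on two nonseparating 3-cycles
`v vᵢ vₖ` and `v vⱼ vₗ` whose link vertices interleave on lk(v). -/
theorem stmt5 [DecidableEq V] (faces : Finset (Finset V)) (h : IrreducibleTri faces)
    (hsphere : eulerChar faces ≠ 2) (v : V) (hv : v ∈ vertexSet faces)
    (d : ℕ) (ℓ : ZMod d → V) (hℓ : IsLink faces v d ℓ) :
    ∃ i j k l : ℕ, i < j ∧ j < k ∧ k < l ∧ l < d ∧
      IsTriCycle faces {v, ℓ (i : ZMod d), ℓ (k : ZMod d)} ∧
      Nonseparating faces {v, ℓ (i : ZMod d), ℓ (k : ZMod d)} ∧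
      IsTriCycle faces {v, ℓ (j : ZMod d), ℓ (l : ZMod d)} ∧
      Nonseparating faces {v, ℓ (j : ZMod d), ℓ (l : ZMod d)} := by
  exact chords_cross h.1 hv hℓ (fun u hu => nonfacial_of_irreducible h hsphere v u hu)
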